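/- Let Δ be a finite simple graph on the vertex set [n] = {1,…,n}, let 𝓕 ⊆ 2^{[n]} be its edge set (so every F ∈ 𝓕 has exactly two elements), and let d_i = 2 for all i (binary variables). Then the marginal polytope P_{𝓕,d} is compressed if and only if Δ has no K₄ minor and every induced cycle in Δ has length at most 4. (Theorem 5.10 of the paper.) -/

import Mathlib

noncomputable section

/-- The unit hypercube `[0,1]^N ⊆ ℝ^N`. -/
def stdCube (N : ℕ) : Set (Fin N → ℝ) := {x | ∀ i, x i ∈ Set.Icc (0 : ℝ) 1}

/-- The set of `0/1` points `{0,1}^N ⊆ ℝ^N`. -/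
def zeroOneSet (N : ℕ) : Set (Fin N → ℝ) := {x | ∀ i, x i = 0 ∨ x i = 1}

/-- A polytope presented as the convex hull of a finite set `A` of integer points in `ℝ^E`
is compressed (characterization (3) of the paper's Theorem 2.4): there are `N ∈ ℕ` and an
affine map `π : ℝ^E → ℝ^N`, injective on `conv A`, mapping every point of `conv A` lying in
the subgroup of `ℤ^E` generated by `A` into `{0,1}^N`, with
`π(conv A) = [0,1]^N ∩ affineSpan ℝ (π(conv A))`. -/
def IsCompressed {E : Type*} (A : Set (E → ℝ)) : Prop :=
  ∃ (N : ℕ) (π : (E → ℝ) →ᵃ[ℝ] (Fin N → ℝ)),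
    Set.InjOn π (convexHull ℝ A) ∧
    (∀ x ∈ convexHull ℝ A ∩ (AddSubgroup.closure A : Set (E → ℝ)), π x ∈ zeroOneSet N) ∧
    π '' convexHull ℝ A
      = stdCube N ∩ (affineSpan ℝ (π '' convexHull ℝ A) : Set (Fin N → ℝ))

/-- The coordinate index set of the marginal problem: pairs `(F, y)` with `F ∈ 𝓕` and
`y ∈ ∏_{i ∈ F} {0,…,d_i − 1}`. -/
def MargIndex {ι : Type*} (𝓕 : Finset (Finset ι)) (d : ι → ℕ) : Type _ :=
  (F : {F // F ∈ 𝓕}) × ((i : {a // a ∈ F.1}) → Fin (d i.1))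

open Classical in
/-- The `0/1` marginal vector `A_x` of a cell `x ∈ ∏_i {0,…,d_i − 1}`: its coordinate at
`(F, y)` is `1` if `x_i = y_i` for all `i ∈ F`, and `0` otherwise.  The marginal polytope
`P_{𝓕,d}` is the convex hull of the vectors `A_x` over all cells `x`. -/
noncomputable def margVec {ι : Type*} (𝓕 : Finset (Finset ι)) (d : ι → ℕ)
    (x : ∀ i, Fin (d i)) : MargIndex 𝓕 d → ℝ :=
  fun p => if ∀ i : {a // a ∈ p.1.1}, x i.1 = p.2 i then 1 else 0


/-- `G` has a `K₄` minor: four pairwise disjoint nonempty vertex subsets, each inducing a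
connected subgraph, with an edge of `G` between every two of them. -/
def HasK4Minor {V : Type*} (G : SimpleGraph V) : Prop :=
  ∃ B : Fin 4 → Set V,
    (∀ i, (B i).Nonempty) ∧
    (∀ i j, i ≠ j → Disjoint (B i) (B j)) ∧
    (∀ i, (G.induce (B i)).Connected) ∧
    (∀ i j, i ≠ j → ∃ u ∈ B i, ∃ v ∈ B j, G.Adj u v)

/-- Every induced cycle of `G` has length at most `4`: for every `k ≥ 3`, every injective
`v : ℤ/k → V` with `v i ~ v j` exactly when `i − j ≡ ±1 (mod k)` forces `k ≤ 4`. -/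
def InducedCyclesLe4 {V : Type*} (G : SimpleGraph V) : Prop :=
  ∀ k : ℕ, 3 ≤ k → ∀ v : ZMod k → V, Function.Injective v →
    (∀ i j, G.Adj (v i) (v j) ↔ (i - j = 1 ∨ j - i = 1)) → k ≤ 4

/-- The induced subgraph on `B` is connected iff `B` is nonempty and every subset closed under
adjacency inside `B` contains all of `B` as soon as it meets `B`. -/
lemma induce_connected_iff_closed {V : Type*} (G : SimpleGraph V) (B : Set V) :
    (G.induce B).Connected ↔ B.Nonempty ∧ ∀ S : Set V,
      (∀ u ∈ B, ∀ w ∈ B, G.Adj u w → u ∈ S → w ∈ S) → ∀ u ∈ B, ∀ w ∈ B, u ∈ S → w ∈ S := by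
  constructor
  · intro h
    refine ⟨Set.nonempty_coe_sort.mp h.nonempty, fun S hS u hu w hw huS => ?_⟩
    obtain ⟨p⟩ := h.preconnected ⟨u, hu⟩ ⟨w, hw⟩
    have key : ∀ (x y : B), (G.induce B).Walk x y → x.1 ∈ S → y.1 ∈ S := by
      intro x y p
      induction p with
      | nil => exact id
      | cons h _ ih => exact fun hx => ih (hS _ (Subtype.prop _) _ (Subtype.prop _) h hx)
    exact key _ _ p huS
  · rintro ⟨⟨r, hr⟩, h⟩
    have : Nonempty B := ⟨⟨r, hr⟩⟩
    refine SimpleGraph.Connected.mk ?_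
    rintro ⟨u, hu⟩ ⟨w, hw⟩
    have := h {y | ∃ hy : y ∈ B, (G.induce B).Reachable ⟨u, hu⟩ ⟨y, hy⟩} ?_ u hu w hw
      ⟨hu, SimpleGraph.Reachable.refl _⟩
    · exact this.2
    · rintro x hx y hy hxy ⟨_, hux⟩
      exact ⟨hy, hux.trans (SimpleGraph.Adj.reachable (by simpa using hxy))⟩

lemma hasK4Minor_of_sets {V : Type*} {G : SimpleGraph V} (B : Fin 4 → Set V)
    (hc : ∀ i, (G.induce (B i)).Connected)
    (hd : ∀ i j, i < j → Disjoint (B i) (B j))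
    (he : ∀ i j, i < j → ∃ u ∈ B i, ∃ v ∈ B j, G.Adj u v) : HasK4Minor G := by
  refine ⟨B, fun i => ((induce_connected_iff_closed G _).1 (hc i)).1, fun i j hij => ?_, hc,
    fun i j hij => ?_⟩
  · rcases lt_or_gt_of_ne hij with h | h
    · exact hd i j h
    · exact (hd j i h).symm
  · rcases lt_or_gt_of_ne hij with h | h
    · exact he i j h
    · obtain ⟨u, hu, v, hv, huv⟩ := he j i h
      exact ⟨v, hv, u, hu, huv.symm⟩

/-- `p 0, …, p k` is a path of `G`. -/
def IsSeqPath {V : Type*} (G : SimpleGraph V) (k : ℕ) (p : ℕ → V) : Prop :=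
  (∀ i ≤ k, ∀ j ≤ k, p i = p j → i = j) ∧ ∀ i < k, G.Adj (p i) (p (i + 1))

lemma IsSeqPath.connected_interval {V : Type*} {G : SimpleGraph V} {k : ℕ} {p : ℕ → V}
    (hp : IsSeqPath G k p) {l r : ℕ} (hlr : l ≤ r) (hr : r ≤ k) :
    (G.induce (p '' Set.Icc l r)).Connected := by
  rw [induce_connected_iff_closed]
  refine ⟨⟨p l, l, ⟨le_rfl, hlr⟩, rfl⟩, ?_⟩
  intro S hS
  have up : ∀ d i, l ≤ i → i + d ≤ r → (p i ∈ S ↔ p (i + d) ∈ S) := by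
    intro d
    induction d with
    | zero => simp
    | succ d ih =>
      intro i hi hd
      rw [ih i hi (by omega)]
      have m1 : p (i + d) ∈ p '' Set.Icc l r := ⟨i + d, ⟨by omega, by omega⟩, rfl⟩
      have m2 : p (i + (d + 1)) ∈ p '' Set.Icc l r := ⟨i + (d + 1), ⟨by omega, by omega⟩, rfl⟩
      have ha : G.Adj (p (i + d)) (p (i + (d + 1))) := hp.2 (i + d) (by omega)
      exact ⟨hS _ m1 _ m2 ha, hS _ m2 _ m1 ha.symm⟩
  rintro _ ⟨i, ⟨hi, hi'⟩, rfl⟩ _ ⟨j, ⟨hj, hj'⟩, rfl⟩ h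
  have h1 := up (i - l) l le_rfl (by omega)
  have h2 := up (j - l) l le_rfl (by omega)
  rw [show l + (i - l) = i by omega] at h1
  rw [show l + (j - l) = j by omega] at h2
  exact h2.1 (h1.2 h)

lemma IsSeqPath.disjoint_interval {V : Type*} {G : SimpleGraph V} {k : ℕ} {p : ℕ → V}
    (hp : IsSeqPath G k p) {l r l' r' : ℕ} (h : r < l') (hr : r' ≤ k) :
    Disjoint (p '' Set.Icc l r) (p '' Set.Icc l' r') := by
  rw [Set.disjoint_left]
  rintro _ ⟨i, ⟨hi, hi'⟩, rfl⟩ ⟨j, ⟨hj, hj'⟩, hij⟩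
  have := hp.1 j (by omega) i (by omega) hij
  omega

/-- A graph with an edge has a path that cannot be prolonged to a longer one elsewhere. -/
lemma exists_longest_seqPath {V : Type*} [Finite V] {G : SimpleGraph V} {x y : V}
    (hxy : G.Adj x y) :
    ∃ k, 1 ≤ k ∧ (∃ p, IsSeqPath G k p) ∧ ∀ p, ¬ IsSeqPath G (k + 1) p := by
  by_contra! hcon
  have all : ∀ k, ∃ p, IsSeqPath G (k + 1) p := by
    intro k
    induction k with
    | zero =>
      refine ⟨fun i => if i = 0 then x else y, ?_, ?_⟩
      · intro i hi j hj
        have := hxy.ne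
        have := hxy.ne'
        interval_cases i <;> interval_cases j <;> simp_all
      · intro i hi
        interval_cases i
        simpa using hxy
    | succ k ih => exact hcon (k + 1) (by omega) ih
  obtain ⟨p, hp⟩ := all (Nat.card V)
  have hinj : Function.Injective (fun i : Fin (Nat.card V + 1 + 1) => p i) := by
    intro i j hij
    exact Fin.ext (hp.1 i (by omega) j (by omega) hij)
  have := Nat.card_le_card_of_injective _ hinj
  simp at this

lemma IsSeqPath.neighbor_mem {V : Type*} {G : SimpleGraph V} {k : ℕ} {p : ℕ → V}
    (hp : IsSeqPath G k p) (hmax : ∀ p, ¬ IsSeqPath G (k + 1) p) {w : V} (hw : G.Adj (p 0) w) :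
    ∃ i ≤ k, w = p i := by
  by_contra! hcon
  refine hmax (fun i => if i = 0 then w else p (i - 1)) ⟨?_, ?_⟩
  · intro i hi j hj hij
    rcases Nat.eq_zero_or_pos i with rfl | hi0 <;> rcases Nat.eq_zero_or_pos j with rfl | hj0
    · rfl
    · simp only [if_true, hj0.ne', if_false] at hij
      exact absurd hij (hcon _ (by omega))
    · simp only [if_true, hi0.ne', if_false] at hij
      exact absurd hij.symm (hcon _ (by omega))
    · simp only [hi0.ne', hj0.ne', if_false] at hij
      have := hp.1 (i - 1) (by omega) (j - 1) (by omega) hij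
      omega
  · intro i hi
    rcases Nat.eq_zero_or_pos i with rfl | hi0
    · simpa using hw.symm
    · have := hp.2 (i - 1) (by omega)
      simp only [hi0.ne', if_false, Nat.succ_ne_zero, Nat.add_sub_cancel]
      rwa [show i - 1 + 1 = i by omega] at this

lemma IsSeqPath.rotate {V : Type*} {G : SimpleGraph V} {k : ℕ} {p : ℕ → V}
    (hp : IsSeqPath G k p) {i : ℕ} (hik : i ≤ k) (h : G.Adj (p 0) (p i)) :
    IsSeqPath G k (fun t => if t < i then p (i - 1 - t) else p t) := by
  constructor
  · intro s hs t ht hst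
    by_cases h1 : s < i <;> by_cases h2 : t < i <;> simp only [h1, h2, if_true, if_false] at hst
    · have := hp.1 _ (by omega) _ (by omega) hst
      omega
    · have := hp.1 _ (by omega) _ (by omega) hst
      omega
    · have := hp.1 _ (by omega) _ (by omega) hst
      omega
    · exact hp.1 _ (by omega) _ (by omega) hst
  · intro s hs
    by_cases h1 : s + 1 < i
    · simp only [h1, show s < i by omega, if_true]
      have := hp.2 (i - 1 - (s + 1)) (by omega)
      rw [show i - 1 - (s + 1) + 1 = i - 1 - s by omega] at this
      exact this.symm
    · by_cases h2 : s < i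
      · simp only [h1, h2, if_true, if_false]
        rw [show i - 1 - s = 0 by omega, show s + 1 = i by omega]
        exact h
      · simp only [h1, h2, if_false]
        exact hp.2 s hs

/-- A graph with an edge and without `K₄` minor has a vertex of degree `1` or `2`. -/
lemma exists_degree_le_two {V : Type*} [Finite V] {G : SimpleGraph V} (hG : ¬ HasK4Minor G)
    {x y : V} (hxy : G.Adj x y) :
    ∃ v a b, ∀ w, G.Adj v w ↔ w = a ∨ w = b := by
  classical
  by_contra! hcon
  obtain ⟨k, hk, ⟨p₀, hp₀⟩, hmax⟩ := exists_longest_seqPath hxy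
  have hQ : ∃ j, ∃ p, IsSeqPath G k p ∧ ∀ w, G.Adj (p 0) w → ∃ i ≤ j, w = p i :=
    ⟨k, p₀, hp₀, fun w hw => hp₀.neighbor_mem hmax hw⟩
  have hjk : Nat.find hQ ≤ k := Nat.find_min' hQ ⟨p₀, hp₀, fun w hw => hp₀.neighbor_mem hmax hw⟩
  obtain ⟨p, hp, hnb⟩ := Nat.find_spec hQ
  have hmin := fun j => Nat.find_min hQ (m := j)
  generalize Nat.find hQ = j at hjk hnb hmin
  have h01 : G.Adj (p 0) (p 1) := hp.2 0 (by omega)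
  have hj1 : 1 ≤ j := by
    obtain ⟨i, hi, h⟩ := hnb _ h01
    have := hp.1 1 (by omega) i (by omega) h
    omega
  have h0j : G.Adj (p 0) (p j) := by
    by_contra h
    refine hmin (j - 1) (by omega) ⟨p, hp, fun w hw => ?_⟩
    obtain ⟨i, hi, rfl⟩ := hnb w hw
    refine ⟨i, ?_, rfl⟩
    rcases Nat.lt_or_ge i j with h' | h'
    · omega
    · exact absurd (by rwa [show i = j by omega] at hw) h
  obtain ⟨i, hi1, hij, h0i⟩ : ∃ i, 1 < i ∧ i < j ∧ G.Adj (p 0) (p i) := by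
    obtain ⟨w, hw⟩ := hcon (p 0) (p 1) (p j)
    rcases hw with ⟨hw, h1, h2⟩ | ⟨hw, h | h⟩
    · obtain ⟨i, hi, rfl⟩ := hnb w hw
      refine ⟨i, ?_, ?_, hw⟩
      · rcases Nat.lt_or_ge 1 i with h | h
        · exact h
        · interval_cases i
          · exact absurd hw (G.irrefl)
          · exact absurd rfl h1
      · exact lt_of_le_of_ne hi (fun h => h2 (by rw [h]))
    · exact absurd (h ▸ h01) hw
    · exact absurd (h ▸ h0j) hw
  have hrot := hp.rotate (by omega) h0i
  obtain ⟨m, him, hmk, hm⟩ : ∃ m, i < m ∧ m ≤ k ∧ G.Adj (p (i - 1)) (p m) := by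
    by_contra! hno
    refine hmin i hij ⟨_, hrot, fun w hw => ?_⟩
    obtain ⟨t, ht, rfl⟩ := hrot.neighbor_mem hmax hw
    refine ⟨t, ?_, rfl⟩
    by_contra hti
    simp only [show 0 < i by omega, show ¬ t < i by omega, if_true, if_false, Nat.sub_zero] at hw
    exact hno t (by omega) ht hw
  set r := max j m with hr
  have hrk : r ≤ k := by omega
  refine hG (hasK4Minor_of_sets ![p '' Set.Icc 0 0, p '' Set.Icc 1 (i - 1), p '' Set.Icc i i,
    p '' Set.Icc (i + 1) r] ?_ ?_ ?_)
  · intro s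
    fin_cases s
    · exact hp.connected_interval (by omega) (by omega)
    · exact hp.connected_interval (by omega) (by omega)
    · exact hp.connected_interval (by omega) (by omega)
    · exact hp.connected_interval (by omega) (by omega)
  · intro s t hst
    fin_cases s <;> fin_cases t <;>
      first
      | exact absurd hst (by decide)
      | exact hp.disjoint_interval (by omega) (by omega)
  · have hmem : ∀ {l r t : ℕ}, l ≤ t → t ≤ r → p t ∈ p '' Set.Icc l r :=
      fun h h' => ⟨_, ⟨h, h'⟩, rfl⟩
    have hi' : G.Adj (p (i - 1)) (p i) := by
      have := hp.2 (i - 1) (by omega)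
      rwa [show i - 1 + 1 = i by omega] at this
    intro s t hst
    fin_cases s <;> fin_cases t <;> first | exact absurd hst (by decide) | skip
    · exact ⟨p 0, hmem (by omega) (by omega), p 1, hmem (by omega) (by omega), h01⟩
    · exact ⟨p 0, hmem (by omega) (by omega), p i, hmem (by omega) (by omega), h0i⟩
    · exact ⟨p 0, hmem (by omega) (by omega), p j, hmem (by omega) (by omega), h0j⟩
    · exact ⟨p (i - 1), hmem (by omega) (by omega), p i, hmem (by omega) (by omega), hi'⟩
    · exact ⟨p (i - 1), hmem (by omega) (by omega), p m, hmem (by omega) (by omega), hm⟩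
    · exact ⟨p i, hmem (by omega) (by omega), p (i + 1), hmem (by omega) (by omega),
        hp.2 i (by omega)⟩

/-- The graph obtained from `G` by deleting all edges at `v` and joining `a` to `b`. -/
def bypass {V : Type*} (G : SimpleGraph V) (v a b : V) : SimpleGraph V where
  Adj u w := (G.Adj u w ∧ u ≠ v ∧ w ≠ v) ∨ (a ≠ b ∧ ((u = a ∧ w = b) ∨ (u = b ∧ w = a)))
  symm := ⟨by
    rintro u w (⟨h, h1, h2⟩ | ⟨h, h1⟩)
    · exact Or.inl ⟨h.symm, h2, h1⟩
    · exact Or.inr ⟨h, by tauto⟩⟩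
  loopless := ⟨by
    rintro u (⟨h, -⟩ | ⟨h, ⟨rfl, rfl⟩ | ⟨rfl, rfl⟩⟩)
    · exact G.irrefl h
    · exact h rfl
    · exact h rfl⟩

section Bypass

variable {V : Type*} {G : SimpleGraph V} {v a b : V}

lemma bypass_adj {u w : V} : (bypass G v a b).Adj u w ↔
    (G.Adj u w ∧ u ≠ v ∧ w ≠ v) ∨ (a ≠ b ∧ ((u = a ∧ w = b) ∨ (u = b ∧ w = a))) := Iff.rfl

lemma bypass_adj_ne (hv : ∀ w, G.Adj v w ↔ w = a ∨ w = b) {u w : V}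
    (h : (bypass G v a b).Adj u w) : u ≠ v ∧ w ≠ v := by
  have ha : a ≠ v := ((hv a).2 (Or.inl rfl)).ne'
  have hb : b ≠ v := ((hv b).2 (Or.inr rfl)).ne'
  rcases h with ⟨-, h⟩ | ⟨-, ⟨rfl, rfl⟩ | ⟨rfl, rfl⟩⟩
  · exact h
  · exact ⟨ha, hb⟩
  · exact ⟨hb, ha⟩

lemma hasK4Minor_of_bypass (hv : ∀ w, G.Adj v w ↔ w = a ∨ w = b)
    (h : HasK4Minor (bypass G v a b)) : HasK4Minor G := by
  obtain ⟨B, -, hd, hc, he⟩ := h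
  have hva : G.Adj v a := (hv a).2 (Or.inl rfl)
  have hvb : G.Adj v b := (hv b).2 (Or.inr rfl)
  have hvB : ∀ i, v ∉ B i := by
    intro i hi
    obtain ⟨j, hj⟩ := exists_ne i
    obtain ⟨u, hu, w, -, huw⟩ := he i j hj.symm
    have hne := bypass_adj_ne hv huw
    refine hne.1 ?_
    have := ((induce_connected_iff_closed _ _).1 (hc i)).2 {v} ?_ v hi u hu rfl
    · exact this
    · rintro x - y - hxy rfl
      exact absurd rfl (bypass_adj_ne hv hxy).1
  refine hasK4Minor_of_sets (fun i => B i ∪ {x | x = v ∧ a ∈ B i}) ?_ ?_ ?_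
  · intro i
    obtain ⟨hne, hcl⟩ := (induce_connected_iff_closed _ _).1 (hc i)
    rw [induce_connected_iff_closed]
    refine ⟨hne.mono Set.subset_union_left, fun S hS => ?_⟩
    have hvS : a ∈ B i → (v ∈ S ↔ a ∈ S) := fun h =>
      ⟨hS v (Or.inr ⟨rfl, h⟩) a (Or.inl h) hva, hS a (Or.inl h) v (Or.inr ⟨rfl, h⟩) hva.symm⟩
    have hbS : a ∈ B i → b ∈ B i → (v ∈ S ↔ b ∈ S) := fun h hb =>
      ⟨hS v (Or.inr ⟨rfl, h⟩) b (Or.inl hb) hvb, hS b (Or.inl hb) v (Or.inr ⟨rfl, h⟩) hvb.symm⟩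
    have key : ∀ u ∈ B i, ∀ w ∈ B i, u ∈ S → w ∈ S := by
      refine hcl S ?_
      rintro x hx y hy (⟨hxy, -⟩ | ⟨-, ⟨rfl, rfl⟩ | ⟨rfl, rfl⟩⟩)
      · exact hS x (Or.inl hx) y (Or.inl hy) hxy
      · rw [← hvS hx, ← hbS hx hy]; exact id
      · rw [← hvS hy, ← hbS hy hx]; exact id
    rintro x (hx | ⟨rfl, hx⟩) y (hy | ⟨rfl, hy⟩) hxS
    · exact key x hx y hy hxS
    · exact (hvS hy).2 (key x hx a hy hxS)
    · exact key a hx y hy ((hvS hx).1 hxS)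
    · exact hxS
  · intro i j hij
    have hdij := Set.disjoint_left.1 (hd i j hij.ne)
    rw [Set.disjoint_left]
    rintro x (hx | ⟨rfl, hx⟩) (hy | ⟨hxv, hy⟩)
    · exact hdij hx hy
    · exact hvB i (hxv ▸ hx)
    · exact hvB j hy
    · exact hdij hx hy
  · intro i j hij
    obtain ⟨x, hx, y, hy, hxy⟩ := he i j hij.ne
    rcases hxy with ⟨hxy, -⟩ | ⟨-, ⟨rfl, rfl⟩ | ⟨rfl, rfl⟩⟩
    · exact ⟨x, Or.inl hx, y, Or.inl hy, hxy⟩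
    · exact ⟨v, Or.inr ⟨rfl, hx⟩, y, Or.inl hy, hvb⟩
    · exact ⟨x, Or.inl hx, v, Or.inr ⟨rfl, hy⟩, hvb.symm⟩

/-- Four vertices `a, v, b` and two further adjacent common neighbours of `a` and `b` carry a
`K₄` minor. -/
lemma hasK4Minor_of_adj_common (hva : G.Adj v a) (hvb : G.Adj v b) (hab : a ≠ b) {w w' : V}
    (hwv : w ≠ v) (hwv' : w' ≠ v) (haw : G.Adj a w) (hbw : G.Adj b w) (haw' : G.Adj a w')
    (hbw' : G.Adj b w') (hww : G.Adj w w') : HasK4Minor G := by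
  have hsingle : ∀ x : V, (G.induce ({x} : Set V)).Connected := by
    intro x
    rw [induce_connected_iff_closed]
    refine ⟨⟨x, rfl⟩, ?_⟩
    rintro S - _ rfl _ rfl h
    exact h
  refine hasK4Minor_of_sets ![{a}, {b, v}, {w}, {w'}] ?_ ?_ ?_
  · intro i
    fin_cases i
    · exact hsingle a
    · exact SimpleGraph.induce_pair_connected_of_adj hvb.symm
    · exact hsingle w
    · exact hsingle w'
  · have := hva.ne'
    have := haw.ne
    have := haw'.ne
    have := hbw.ne'
    have := hbw'.ne'
    have := hww.ne
    intro i j hij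
    fin_cases i <;> fin_cases j <;> first | exact absurd hij (by decide) | skip
    all_goals simp [Set.disjoint_left]
    all_goals grind
  · intro i j hij
    fin_cases i <;> fin_cases j <;> first | exact absurd hij (by decide) | skip
    · exact ⟨a, by simp, v, by simp, hva.symm⟩
    · exact ⟨a, by simp, w, by simp, haw⟩
    · exact ⟨a, by simp, w', by simp, haw'⟩
    · exact ⟨b, by simp, w, by simp, hbw⟩
    · exact ⟨b, by simp, w', by simp, hbw'⟩
    · exact ⟨w, by simp, w', by simp, hww⟩

end Bypass

/-- `c 0, …, c (k - 1)` is an induced cycle of `G`. -/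
def IsSeqCycle {V : Type*} (G : SimpleGraph V) (k : ℕ) (c : ℕ → V) : Prop :=
  (∀ i < k, ∀ j < k, c i = c j → i = j) ∧
  ∀ i j, i < j → j < k → (G.Adj (c i) (c j) ↔ j = i + 1 ∨ (i = 0 ∧ j + 1 = k))

lemma zmod_adjacent_iff {k i j : ℕ} (hij : i < j) (hj : j < k) :
    ((i : ZMod k) - j = 1 ∨ (j : ZMod k) - i = 1) ↔ j = i + 1 ∨ (i = 0 ∧ j + 1 = k) := by
  rw [sub_eq_iff_eq_add, sub_eq_iff_eq_add]
  have h1 : ((i : ZMod k) = 1 + j) ↔ i = 0 ∧ j + 1 = k := by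
    rw [show (1 + j : ZMod k) = ((j + 1 : ℕ) : ZMod k) by push_cast; ring,
      ZMod.natCast_eq_natCast_iff', Nat.mod_eq_of_lt (by omega : i < k)]
    rcases Nat.lt_or_ge (j + 1) k with h | h
    · rw [Nat.mod_eq_of_lt h]; omega
    · rw [show j + 1 = k by omega, Nat.mod_self]; omega
  have h2 : ((j : ZMod k) = 1 + i) ↔ j = i + 1 := by
    rw [show (1 + i : ZMod k) = ((i + 1 : ℕ) : ZMod k) by push_cast; ring,
      ZMod.natCast_eq_natCast_iff', Nat.mod_eq_of_lt hj, Nat.mod_eq_of_lt (by omega)]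
  rw [h1, h2]; tauto

/-- An induced cycle indexed by `ℤ/k`, read off along an adjacency preserving bijection
of `ℤ/k`. -/
lemma isSeqCycle_of_zmod {V : Type*} {G : SimpleGraph V} {k : ℕ} {u : ZMod k → V}
    (hu : Function.Injective u) (hadj : ∀ i j, G.Adj (u i) (u j) ↔ (i - j = 1 ∨ j - i = 1))
    {f : ZMod k → ZMod k} (hf : Function.Injective f)
    (hf' : ∀ i j, (f i - f j = 1 ∨ f j - f i = 1) ↔ (i - j = 1 ∨ j - i = 1)) :
    IsSeqCycle G k (fun t => u (f t)) := by
  constructor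
  · intro i hi j hj hij
    have := hf (hu hij)
    rwa [ZMod.natCast_eq_natCast_iff', Nat.mod_eq_of_lt hi, Nat.mod_eq_of_lt hj] at this
  · intro i j hij hj
    rw [hadj, hf', zmod_adjacent_iff hij hj]

lemma IsSeqCycle.le_four {V : Type*} {G : SimpleGraph V} (hG : InducedCyclesLe4 G) {k : ℕ}
    {c : ℕ → V} (hk : 3 ≤ k) (hc : IsSeqCycle G k c) : k ≤ 4 := by
  have : NeZero k := ⟨by omega⟩
  have hcast : ∀ i : ZMod k, ((i.val : ℕ) : ZMod k) = i := fun i => ZMod.natCast_zmod_val i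
  have hlt : ∀ i j : ZMod k, i.val < j.val →
      (G.Adj (c i.val) (c j.val) ↔ (i - j = 1 ∨ j - i = 1)) := by
    intro i j h
    rw [hc.2 _ _ h (ZMod.val_lt j), ← zmod_adjacent_iff h (ZMod.val_lt j), hcast, hcast]
  refine hG k hk (fun i => c i.val) ?_ ?_
  · intro i j hij
    exact ZMod.val_injective k (hc.1 _ (ZMod.val_lt i) _ (ZMod.val_lt j) hij)
  · intro i j
    rcases lt_trichotomy i.val j.val with h | h | h
    · exact hlt i j h
    · have := ZMod.val_injective k h
      subst this
      have h1 : (0 : ZMod k) ≠ 1 := by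
        have : Fact (1 < k) := ⟨by omega⟩
        exact zero_ne_one
      simp [h1]
    · rw [SimpleGraph.adj_comm, hlt j i h, or_comm]

section BypassCycle

variable {V : Type*} {G : SimpleGraph V} {v a b : V}

lemma bypass_adj_iff_of_not_pair {u w : V}
    (hu : u ≠ v) (hw : w ≠ v) (h : ¬ ((u = a ∧ w = b) ∨ (u = b ∧ w = a))) :
    (bypass G v a b).Adj u w ↔ G.Adj u w := by
  rw [bypass_adj]; tauto

lemma bypass_adj_iff_of_adj (h : a = b ∨ G.Adj a b) {u w : V}
    (hu : u ≠ v) (hw : w ≠ v) : (bypass G v a b).Adj u w ↔ G.Adj u w := by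
  rw [bypass_adj]
  constructor
  · rintro (h' | ⟨h1, ⟨rfl, rfl⟩ | ⟨rfl, rfl⟩⟩)
    · exact h'.1
    · exact h.resolve_left h1
    · exact (h.resolve_left h1).symm
  · exact fun h => Or.inl ⟨h, hu, hw⟩

/-- When `a` and `b` are distinct and not adjacent in `G`, an induced cycle of length at least
four of the bypass graph does not use the new edge. -/
lemma bypass_cycle_not_both (hG : InducedCyclesLe4 G) (hv : ∀ w, G.Adj v w ↔ w = a ∨ w = b)
    (hab : a ≠ b) (hnab : ¬ G.Adj a b) {k : ℕ} (hk : 4 ≤ k) {u : ZMod k → V}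
    (hu : Function.Injective u)
    (hadj : ∀ i j, (bypass G v a b).Adj (u i) (u j) ↔ (i - j = 1 ∨ j - i = 1)) (i j : ZMod k)
    (hi : u i = a) (hj : u j = b) : False := by
  obtain ⟨c, hc, hc0, hck⟩ : ∃ c, IsSeqCycle (bypass G v a b) k c ∧ c 0 = a ∧ c (k - 1) = b := by
    have hij : (bypass G v a b).Adj (u i) (u j) := Or.inr ⟨hab, Or.inl ⟨hi, hj⟩⟩
    have hk1 : ((k - 1 : ℕ) : ZMod k) = -1 := by
      rw [Nat.cast_sub (by omega)]; simp
    rcases (hadj i j).1 hij with h | h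
    · refine ⟨_, isSeqCycle_of_zmod hu hadj (f := fun t => i + t)
        (add_right_injective i) (fun x y => by simp), by simpa using hi, ?_⟩
      simp only [hk1]
      rw [← hj]; congr 1; rw [← h]; ring
    · refine ⟨_, isSeqCycle_of_zmod hu hadj (f := fun t => i - t)
        (sub_right_injective) (fun x y => by simp [or_comm]), by simpa using hi, ?_⟩
      simp only [hk1]
      rw [← hj]; congr 1; rw [← h]; ring
  have hnv : ∀ t < k, c t ≠ v := by
    intro t ht
    rcases Nat.eq_zero_or_pos t with rfl | h0
    · rw [hc0]; exact ((hv a).2 (Or.inl rfl)).ne'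
    · have := (hc.2 (t - 1) t (by omega) ht).2 (Or.inl (by omega))
      exact (bypass_adj_ne hv this).2
  have : IsSeqCycle G (k + 1) (fun t => if t < k then c t else v) := by
    constructor
    · intro s hs t ht hst
      by_cases h1 : s < k <;> by_cases h2 : t < k <;>
        simp only [h1, h2, if_true, if_false] at hst
      · exact hc.1 s h1 t h2 hst
      · exact absurd hst (hnv s h1)
      · exact absurd hst.symm (hnv t h2)
      · omega
    · intro s t hst ht
      have h1 : s < k := by omega
      by_cases h2 : t < k
      · simp only [h1, h2, if_true]
        by_cases hpair : s = 0 ∧ t + 1 = k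
        · obtain ⟨rfl, rfl⟩ := hpair
          have hck' : c t = b := by simpa using hck
          rw [hc0, hck']
          refine ⟨fun h => absurd h hnab, fun h => ?_⟩
          omega
        · rw [← bypass_adj_iff_of_not_pair (hnv s h1) (hnv t h2), hc.2 s t hst h2]
          · omega
          · rintro (⟨hs, ht⟩ | ⟨hs, ht⟩)
            · have e1 := hc.1 s h1 0 (by omega) (hs.trans hc0.symm)
              have e2 := hc.1 t h2 (k - 1) (by omega) (ht.trans hck.symm)
              omega
            · have e1 := hc.1 s h1 (k - 1) (by omega) (hs.trans hck.symm)
              have e2 := hc.1 t h2 0 (by omega) (ht.trans hc0.symm)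
              omega
      · simp only [h1, h2, if_true, if_false]
        rw [SimpleGraph.adj_comm, hv]
        constructor
        · rintro (h | h)
          · have := hc.1 s h1 0 (by omega) (h.trans hc0.symm)
            omega
          · have := hc.1 s h1 (k - 1) (by omega) (h.trans hck.symm)
            omega
        · rintro (h | ⟨h, -⟩)
          · right; rw [← hck]; congr 1; omega
          · left; rw [h, hc0]
  have := this.le_four hG (by omega)
  omega

lemma inducedCyclesLe4_bypass (hG : InducedCyclesLe4 G) (hv : ∀ w, G.Adj v w ↔ w = a ∨ w = b) :
    InducedCyclesLe4 (bypass G v a b) := by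
  intro k hk u hu hadj
  by_contra! hk4
  have hnv : ∀ i, u i ≠ v := fun i =>
    (bypass_adj_ne hv ((hadj i (i + 1)).2 (Or.inr (by ring)))).1
  by_cases hab : a = b ∨ G.Adj a b
  · have := hG k hk u hu fun i j => by
      rw [← hadj, bypass_adj_iff_of_adj hab (hnv i) (hnv j)]
    omega
  · push Not at hab
    have hnot := bypass_cycle_not_both hG hv hab.1 hab.2 (by omega) hu hadj
    have := hG k hk u hu fun i j => by
      rw [← hadj, bypass_adj_iff_of_not_pair (hnv i) (hnv j)]
      rintro (⟨h1, h2⟩ | ⟨h1, h2⟩)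
      · exact hnot i j h1 h2
      · exact hnot j i h2 h1
    omega

/-- The four-cycle `p q r s` without its two diagonals. -/
def IsInducedSquare {V : Type*} (G : SimpleGraph V) (p q r s : V) : Prop :=
  G.Adj p q ∧ G.Adj q r ∧ G.Adj r s ∧ G.Adj s p ∧ ¬ G.Adj p r ∧ ¬ G.Adj q s ∧ p ≠ r ∧ q ≠ s

lemma IsInducedSquare.of_bypass (hG : InducedCyclesLe4 G)
    (hv : ∀ w, G.Adj v w ↔ w = a ∨ w = b) {p q r s : V}
    (h : IsInducedSquare (bypass G v a b) p q r s) :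
    IsInducedSquare G p q r s := by
  have hp : p ≠ v := (bypass_adj_ne hv h.1).1
  have hq : q ≠ v := (bypass_adj_ne hv h.1).2
  have hr : r ≠ v := (bypass_adj_ne hv h.2.1).2
  have hs : s ≠ v := (bypass_adj_ne hv h.2.2.1).2
  by_cases hab : a = b ∨ G.Adj a b
  · have e := @bypass_adj_iff_of_adj _ G v a b hab
    simpa only [IsInducedSquare, e hp hq, e hq hr, e hr hs, e hs hp, e hp hr, e hq hs] using h
  · push Not at hab
    obtain ⟨h1, h2, h3, h4, h5, h6, h7, h8⟩ := id h
    have hinj : Function.Injective (![p, q, r, s] : ZMod 4 → V) := by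
      have := h1.ne
      have := h2.ne
      have := h3.ne
      have := h4.ne
      intro i j hij
      fin_cases i <;> fin_cases j <;> simp_all
    have hadj : ∀ i j : ZMod 4, (bypass G v a b).Adj ((![p, q, r, s] : ZMod 4 → V) i)
        ((![p, q, r, s] : ZMod 4 → V) j) ↔ (i - j = 1 ∨ j - i = 1) := by
      have t : ∀ {x y : Prop}, x → y → (x ↔ y) := fun hx hy => ⟨fun _ => hy, fun _ => hx⟩
      have t' : ∀ {x y : Prop}, ¬ x → ¬ y → (x ↔ y) :=
        fun hx hy => ⟨fun h => absurd h hx, fun h => absurd h hy⟩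
      intro i j
      fin_cases i <;> fin_cases j <;>
        first
        | exact t h1 (by decide)
        | exact t h2 (by decide)
        | exact t h3 (by decide)
        | exact t h4 (by decide)
        | exact t h1.symm (by decide)
        | exact t h2.symm (by decide)
        | exact t h3.symm (by decide)
        | exact t h4.symm (by decide)
        | exact t' (SimpleGraph.irrefl _) (by decide)
        | exact t' h5 (by decide)
        | exact t' h6 (by decide)
        | exact t' (fun h => h5 h.symm) (by decide)
        | exact t' (fun h => h6 h.symm) (by decide)
    have hnot := bypass_cycle_not_both hG hv hab.1 hab.2 le_rfl hinj hadj
    have hmem : ∀ x ∈ [p, q, r, s], ∃ i : ZMod 4, (![p, q, r, s] : ZMod 4 → V) i = x := by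
      intro x hx
      simp only [List.mem_cons, List.not_mem_nil, or_false] at hx
      rcases hx with rfl | rfl | rfl | rfl
      · exact ⟨0, rfl⟩
      · exact ⟨1, rfl⟩
      · exact ⟨2, rfl⟩
      · exact ⟨3, rfl⟩
    have hno : ∀ x ∈ [p, q, r, s], ∀ y ∈ [p, q, r, s], ¬ (x = a ∧ y = b) := by
      rintro x hx y hy ⟨rfl, rfl⟩
      obtain ⟨i, hi⟩ := hmem x hx
      obtain ⟨j, hj⟩ := hmem y hy
      exact hnot i j hi hj
    have e : ∀ {x y : V}, x ∈ [p, q, r, s] → y ∈ [p, q, r, s] → x ≠ v → y ≠ v →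
        ((bypass G v a b).Adj x y ↔ G.Adj x y) := by
      intro x y hx hy hxv hyv
      refine bypass_adj_iff_of_not_pair hxv hyv ?_
      rintro (hxy | hxy)
      · exact hno x hx y hy hxy
      · exact hno y hy x hx hxy.symm
    have mp : p ∈ [p, q, r, s] := by simp
    have mq : q ∈ [p, q, r, s] := by simp
    have mr : r ∈ [p, q, r, s] := by simp
    have ms : s ∈ [p, q, r, s] := by simp
    simpa only [IsInducedSquare, e mp mq hp hq, e mq mr hq hr, e mr ms hr hs, e ms mp hs hp,
      e mp mr hp hr, e mq ms hq hs] using h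

end BypassCycle

/-- The spin `±1` of a binary value. -/
def spin : Fin 2 → ℝ := ![1, -1]

@[simp] lemma spin_zero : spin 0 = 1 := rfl
@[simp] lemma spin_one : spin 1 = -1 := rfl

lemma spin_mul_self (c : Fin 2) : spin c * spin c = 1 := by
  fin_cases c <;> simp

/-- The four triangle inequalities of the cut polytope in spin coordinates. -/
def TriangleIneq (x y z : ℝ) : Prop := |x + y| ≤ 1 + z ∧ |x - y| ≤ 1 - z

lemma triangleIneq_iff {x y z : ℝ} : TriangleIneq x y z ↔
    0 ≤ 1 + x + y + z ∧ 0 ≤ 1 + x - y - z ∧ 0 ≤ 1 - x + y - z ∧ 0 ≤ 1 - x - y + z := by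
  simp only [TriangleIneq, abs_le]
  constructor
  · rintro ⟨⟨h1, h2⟩, h3, h4⟩
    refine ⟨?_, ?_, ?_, ?_⟩ <;> linarith
  · rintro ⟨h1, h2, h3, h4⟩
    refine ⟨⟨?_, ?_⟩, ?_, ?_⟩ <;> linarith

lemma TriangleIneq.swap {x y z : ℝ} (h : TriangleIneq x y z) : TriangleIneq y x z := by
  rw [triangleIneq_iff] at *
  obtain ⟨h1, h2, h3, h4⟩ := h
  refine ⟨?_, ?_, ?_, ?_⟩ <;> linarith

lemma TriangleIneq.rotate {x y z : ℝ} (h : TriangleIneq x y z) : TriangleIneq y z x := by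
  rw [triangleIneq_iff] at *
  obtain ⟨h1, h2, h3, h4⟩ := h
  refine ⟨?_, ?_, ?_, ?_⟩ <;> linarith

lemma TriangleIneq.abs_le_one {x y z : ℝ} (h : TriangleIneq x y z) : |z| ≤ 1 := by
  rw [triangleIneq_iff] at h
  obtain ⟨h1, h2, h3, h4⟩ := h
  rw [abs_le]
  constructor <;> linarith

lemma triangleIneq_self_one {x : ℝ} (h : |x| ≤ 1) : TriangleIneq x x 1 := by
  rw [triangleIneq_iff]
  rw [abs_le] at h
  refine ⟨?_, ?_, ?_, ?_⟩ <;> linarith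

lemma exists_ratio {N D : ℝ} (h : |N| ≤ D) : ∃ κ : ℝ, |κ| ≤ 1 ∧ κ * D = N := by
  rcases (abs_nonneg N |>.trans h).eq_or_lt with h0 | h0
  · refine ⟨0, by simp, ?_⟩
    rw [← h0] at h
    rw [zero_mul, abs_nonpos_iff.1 h]
  · refine ⟨N / D, ?_, div_mul_cancel₀ _ h0.ne'⟩
    rw [abs_div, abs_of_pos h0, div_le_one h0]
    exact h

/-- Three binary variables with prescribed means and pair moments: the conditional mean of one
variable given the two others. -/
lemma exists_conditional_mean {ma mb mv ea eb t : ℝ} (h1 : TriangleIneq ma mv ea)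
    (h2 : TriangleIneq mb mv eb) (h3 : TriangleIneq ma mb t) (h4 : TriangleIneq ea eb t) :
    ∃ k₀ k₁ k₂ k₃ : ℝ,
      (∀ α β : Fin 2, |k₀ + k₁ * spin α + k₂ * spin β + k₃ * (spin α * spin β)| ≤ 1) ∧
      k₀ + k₁ * ma + k₂ * mb + k₃ * t = mv ∧
      k₀ * ma + k₁ + k₂ * t + k₃ * mb = ea ∧
      k₀ * mb + k₁ * t + k₂ + k₃ * ma = eb := by
  rw [triangleIneq_iff] at h1 h2 h3 h4
  obtain ⟨a1, a2, a3, a4⟩ := h1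
  obtain ⟨b1, b2, b3, b4⟩ := h2
  obtain ⟨c1, c2, c3, c4⟩ := h3
  obtain ⟨d1, d2, d3, d4⟩ := h4
  obtain ⟨τ, hτ1, hτ2, hτ3, hτ4⟩ : ∃ τ : ℝ,
      |mv + ea + eb + τ| ≤ 1 + ma + mb + t ∧ |mv + ea - eb - τ| ≤ 1 + ma - mb - t ∧
      |mv - ea + eb - τ| ≤ 1 - ma + mb - t ∧ |mv - ea - eb + τ| ≤ 1 - ma - mb + t := by
    refine ⟨max (max (-(1 + ma + mb + t) - (mv + ea + eb)) (mv + ea - eb - (1 + ma - mb - t)))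
      (max (mv - ea + eb - (1 - ma + mb - t)) (-(1 - ma - mb + t) - (mv - ea - eb))), ?_⟩
    set τ := max (max (-(1 + ma + mb + t) - (mv + ea + eb)) (mv + ea - eb - (1 + ma - mb - t)))
      (max (mv - ea + eb - (1 - ma + mb - t)) (-(1 - ma - mb + t) - (mv - ea - eb))) with hτ
    have l1 : -(1 + ma + mb + t) - (mv + ea + eb) ≤ τ := by simp [hτ]
    have l2 : mv + ea - eb - (1 + ma - mb - t) ≤ τ := by simp [hτ]
    have l3 : mv - ea + eb - (1 - ma + mb - t) ≤ τ := by simp [hτ]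
    have l4 : -(1 - ma - mb + t) - (mv - ea - eb) ≤ τ := by simp [hτ]
    have u1 : τ ≤ 1 + ma + mb + t - (mv + ea + eb) := by
      refine max_le (max_le ?_ ?_) (max_le ?_ ?_) <;> linarith
    have u2 : τ ≤ 1 + ma - mb - t + (mv + ea - eb) := by
      refine max_le (max_le ?_ ?_) (max_le ?_ ?_) <;> linarith
    have u3 : τ ≤ 1 - ma + mb - t + (mv - ea + eb) := by
      refine max_le (max_le ?_ ?_) (max_le ?_ ?_) <;> linarith
    have u4 : τ ≤ 1 - ma - mb + t - (mv - ea - eb) := by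
      refine max_le (max_le ?_ ?_) (max_le ?_ ?_) <;> linarith
    simp only [abs_le]
    refine ⟨⟨?_, ?_⟩, ⟨?_, ?_⟩, ⟨?_, ?_⟩, ?_, ?_⟩ <;> linarith
  obtain ⟨κ₁, hκ₁, e1⟩ := exists_ratio hτ1
  obtain ⟨κ₂, hκ₂, e2⟩ := exists_ratio hτ2
  obtain ⟨κ₃, hκ₃, e3⟩ := exists_ratio hτ3
  obtain ⟨κ₄, hκ₄, e4⟩ := exists_ratio hτ4
  refine ⟨(κ₁ + κ₂ + κ₃ + κ₄) / 4, (κ₁ + κ₂ - κ₃ - κ₄) / 4, (κ₁ - κ₂ + κ₃ - κ₄) / 4,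
    (κ₁ - κ₂ - κ₃ + κ₄) / 4, ?_, ?_, ?_, ?_⟩
  · intro α β
    fin_cases α <;> fin_cases β <;> simp only [Fin.zero_eta, Fin.mk_one, spin_zero, spin_one]
    · convert hκ₁ using 2; ring
    · convert hκ₂ using 2; ring
    · convert hκ₃ using 2; ring
    · convert hκ₄ using 2; ring
  · linear_combination (e1 + e2 + e3 + e4) / 4
  · linear_combination (e1 + e2 - e3 - e4) / 4
  · linear_combination (e1 - e2 + e3 - e4) / 4

lemma exists_between_families {ι : Type*} [Finite ι] [Nonempty ι] {L U : ι → ℝ}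
    (h : ∀ i j, L i ≤ U j) : ∃ t, ∀ i, L i ≤ t ∧ t ≤ U i := by
  obtain ⟨i, hi⟩ := Finite.exists_max L
  exact ⟨L i, fun j => ⟨hi j, h i j⟩⟩

/-- A finitely supported probability distribution on binary states with means `m` and, along the
edges of `G`, pair moments `e`. -/
structure SpinModel {V : Type*} (G : SimpleGraph V) (m : V → ℝ) (e : V → V → ℝ) where
  index : Type
  fintype : Fintype index
  weight : index → ℝ
  state : index → V → Fin 2
  weight_nonneg : ∀ i, 0 ≤ weight i
  sum_weight : ∑ i, weight i = 1
  mean : ∀ u, ∑ i, weight i * spin (state i u) = m u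
  pair : ∀ u w, G.Adj u w → ∑ i, weight i * (spin (state i u) * spin (state i w)) = e u w

/-- Resampling the spin at `v` with conditional mean `κ`. -/
lemma exists_resample {V ι : Type} [DecidableEq V] [Fintype ι] (w : ι → ℝ) (s : ι → V → Fin 2)
    (hw : ∀ i, 0 ≤ w i) (hs : ∑ i, w i = 1) (v : V) (κ : ι → ℝ) (hκ : ∀ i, |κ i| ≤ 1) :
    ∃ (w' : ι × Fin 2 → ℝ) (s' : ι × Fin 2 → V → Fin 2), (∀ i, 0 ≤ w' i) ∧ ∑ i, w' i = 1 ∧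
      (∀ f : (V → Fin 2) → ℝ, (∀ x c, f (Function.update x v c) = f x) →
        ∑ i, w' i * f (s' i) = ∑ i, w i * f (s i)) ∧
      (∀ f : (V → Fin 2) → ℝ, (∀ x c, f (Function.update x v c) = f x) →
        ∑ i, w' i * (spin (s' i v) * f (s' i)) = ∑ i, w i * (κ i * f (s i))) := by
  refine ⟨fun p => w p.1 * ((1 + spin p.2 * κ p.1) / 2),
    fun p => Function.update (s p.1) v p.2, ?_, ?_, ?_, ?_⟩
  · rintro ⟨i, c⟩
    have := abs_le.1 (hκ i)
    refine mul_nonneg (hw i) ?_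
    fin_cases c <;> simp <;> linarith
  · rw [Fintype.sum_prod_type]
    refine Eq.trans ?_ hs
    refine Finset.sum_congr rfl fun i _ => ?_
    simp only [Fin.sum_univ_two, spin_zero, spin_one]
    ring
  · intro f hf
    rw [Fintype.sum_prod_type]
    refine Finset.sum_congr rfl fun i _ => ?_
    simp only [Fin.sum_univ_two, spin_zero, spin_one, hf]
    ring
  · intro f hf
    rw [Fintype.sum_prod_type]
    refine Finset.sum_congr rfl fun i _ => ?_
    simp only [Fin.sum_univ_two, spin_zero, spin_one, hf, Function.update_self]
    ring

lemma exists_model_of_edgeless {V : Type} [Fintype V] {G : SimpleGraph V}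
    (hG : ∀ u w, ¬ G.Adj u w) (m : V → ℝ) (e : V → V → ℝ) (hm : ∀ u, |m u| ≤ 1) :
    Nonempty (SpinModel G m e) := by
  classical
  have key : ∀ S : Finset V, ∃ (ι : Type) (_ : Fintype ι) (w : ι → ℝ) (s : ι → V → Fin 2),
      (∀ i, 0 ≤ w i) ∧ ∑ i, w i = 1 ∧ ∀ u ∈ S, ∑ i, w i * spin (s i u) = m u := by
    intro S
    induction S using Finset.induction_on with
    | empty => exact ⟨Unit, inferInstance, fun _ => 1, fun _ _ => 0, by simp, by simp, by simp⟩
    | insert v S hv ih =>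
      obtain ⟨ι, _, w, s, hw, hs, hS⟩ := ih
      obtain ⟨w', s', hw', hs', h1, h2⟩ :=
        exists_resample w s hw hs v (fun _ => m v) (fun _ => hm v)
      refine ⟨_, inferInstance, w', s', hw', hs', ?_⟩
      intro u hu
      by_cases huv : u = v
      · subst huv
        have := h2 (fun _ => 1) (fun _ _ => rfl)
        simpa [← Finset.sum_mul, hs] using this
      · rw [h1 (fun x => spin (x u)) (by intro x c; simp [huv])]
        exact hS u ((Finset.mem_insert.1 hu).resolve_left huv)
  obtain ⟨ι, hι, w, s, hw, hs, hS⟩ := key Finset.univ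
  exact ⟨⟨ι, hι, w, s, hw, hs, fun u => hS u (Finset.mem_univ u),
    fun u w h => absurd h (hG u w)⟩⟩

/-- The pair moment along the new edge of the bypass graph. -/
lemma exists_bypass_moment {V : Type} [Finite V] {G : SimpleGraph V} (hK : ¬ HasK4Minor G)
    {m : V → ℝ} {e : V → V → ℝ} (hsymm : ∀ u w, e u w = e w u)
    (hE : ∀ u w, G.Adj u w → TriangleIneq (m u) (m w) (e u w))
    (hT : ∀ u w x, G.Adj u w → G.Adj w x → G.Adj u x →
      TriangleIneq (e u w) (e w x) (e u x))
    (hS : ∀ p q r s, IsInducedSquare G p q r s → |e p q + e q r| + |e r s - e s p| ≤ 2)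
    {v a b : V} (hv : ∀ w, G.Adj v w ↔ w = a ∨ w = b) :
    ∃ t, TriangleIneq (m a) (m b) t ∧
      (∀ w, G.Adj a w → G.Adj b w → TriangleIneq (e a w) (e b w) t) ∧
      (a = b → t = 1) ∧ (G.Adj a b → t = e a b) := by
  have hva : G.Adj v a := (hv a).2 (Or.inl rfl)
  have hvb : G.Adj v b := (hv b).2 (Or.inr rfl)
  by_cases hab : a = b
  · subst hab
    refine ⟨1, triangleIneq_self_one (hE v a hva).rotate.rotate.abs_le_one, ?_,
      fun _ => rfl, fun h => absurd h G.irrefl⟩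
    intro w h _
    exact triangleIneq_self_one (hE _ _ h).abs_le_one
  by_cases hadj : G.Adj a b
  · refine ⟨e a b, hE a b hadj, ?_, fun h => absurd h hab, fun _ => rfl⟩
    intro w h1 h2
    have := hT a w b h1 h2.symm hadj
    rwa [hsymm w b] at this
  have hcross : ∀ w, G.Adj a w → G.Adj b w →
      |m a + m b| + |e a w - e b w| ≤ 2 ∧ |e a w + e b w| + |m a - m b| ≤ 2 := by
    intro w h1 h2
    obtain ⟨a1, a2, a3, a4⟩ := triangleIneq_iff.1 (hE a w h1)
    obtain ⟨b1, b2, b3, b4⟩ := triangleIneq_iff.1 (hE b w h2)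
    constructor
    · rcases abs_cases (m a + m b) with ⟨h, -⟩ | ⟨h, -⟩ <;>
      rcases abs_cases (e a w - e b w) with ⟨h', -⟩ | ⟨h', -⟩ <;> rw [h, h'] <;> linarith
    · rcases abs_cases (m a - m b) with ⟨h, -⟩ | ⟨h, -⟩ <;>
      rcases abs_cases (e a w + e b w) with ⟨h', -⟩ | ⟨h', -⟩ <;> rw [h, h'] <;> linarith
  have hsame : ∀ x y : ℝ, |x| ≤ 1 → |y| ≤ 1 → |x + y| + |x - y| ≤ 2 := by
    intro x y hx hy
    rw [abs_le] at hx hy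
    rcases abs_cases (x + y) with ⟨h, -⟩ | ⟨h, -⟩ <;>
    rcases abs_cases (x - y) with ⟨h', -⟩ | ⟨h', -⟩ <;> rw [h, h'] <;> linarith
  have hpair : ∀ w w', G.Adj a w → G.Adj b w → G.Adj a w' → G.Adj b w' →
      |e a w + e b w| + |e a w' - e b w'| ≤ 2 := by
    intro w w' h1 h2 h3 h4
    by_cases hww : w = w'
    · subst hww
      exact hsame _ _ (hE _ _ h1).abs_le_one (hE _ _ h2).abs_le_one
    have hnadj : ¬ G.Adj w w' := by
      intro h
      by_cases hwv : w = v
      · subst hwv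
        rcases (hv w').1 h with rfl | rfl
        · exact G.irrefl h3
        · exact G.irrefl h4
      by_cases hwv' : w' = v
      · subst hwv'
        rcases (hv w).1 h.symm with rfl | rfl
        · exact G.irrefl h1
        · exact G.irrefl h2
      exact hK (hasK4Minor_of_adj_common hva hvb hab hwv hwv' h1 h2 h3 h4 h)
    have := hS a w b w' ⟨h1, h2.symm, h4, h3.symm, hadj, hnadj, hab, hww⟩
    rwa [hsymm w b, hsymm w' a, abs_sub_comm (e b w')] at this
  obtain ⟨t, ht⟩ := exists_between_families (ι := Option {w // G.Adj a w ∧ G.Adj b w})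
    (L := fun i => i.elim (|m a + m b| - 1) (fun w => |e a w + e b w| - 1))
    (U := fun i => i.elim (1 - |m a - m b|) (fun w => 1 - |e a w - e b w|)) (by
      rintro (_ | ⟨w, h1, h2⟩) (_ | ⟨w', h3, h4⟩)
      · have := hsame (m a) (m b) (hE v a hva).rotate.rotate.abs_le_one
          (hE v b hvb).rotate.rotate.abs_le_one
        simp only [Option.elim]
        linarith
      · have := (hcross w' h3 h4).1
        simp only [Option.elim]
        linarith
      · have := (hcross w h1 h2).2
        simp only [Option.elim]
        linarith
      · have := hpair w w' h1 h2 h3 h4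
        simp only [Option.elim]
        linarith)
  refine ⟨t, ?_, ?_, fun h => absurd h hab, fun h => absurd h hadj⟩
  · have := ht none
    simp only [Option.elim] at this
    exact ⟨by linarith, by linarith⟩
  · intro w h1 h2
    have := ht (some ⟨w, h1, h2⟩)
    simp only [Option.elim] at this
    exact ⟨by linarith, by linarith⟩

/-- Extending a model of the bypass graph over the vertex `v`. -/
lemma SpinModel.extend {V : Type} {G : SimpleGraph V} {m : V → ℝ} {e e' : V → V → ℝ}
    {v a b : V} {t : ℝ} (hsymm : ∀ u w, e u w = e w u) (hv : ∀ w, G.Adj v w ↔ w = a ∨ w = b)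
    (hva : TriangleIneq (m a) (m v) (e v a)) (hvb : TriangleIneq (m b) (m v) (e v b))
    (hab : TriangleIneq (m a) (m b) t) (hvab : TriangleIneq (e v a) (e v b) t)
    (he : ∀ u w, G.Adj u w → e' u w = e u w) (ht : a ≠ b → e' a b = t) (ht1 : a = b → t = 1)
    (M : SpinModel (bypass G v a b) m e') : Nonempty (SpinModel G m e) := by
  classical
  have hav : a ≠ v := ((hv a).2 (Or.inl rfl)).ne'
  have hbv : b ≠ v := ((hv b).2 (Or.inr rfl)).ne'
  obtain ⟨ι, hι, w, s, hw, hs, hm, hp⟩ := M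
  obtain ⟨k₀, k₁, k₂, k₃, hκ, e₁, e₂, e₃⟩ := exists_conditional_mean hva hvb hab hvab
  have hst : ∑ i, w i * (spin (s i a) * spin (s i b)) = t := by
    by_cases h : a = b
    · subst h
      simp only [spin_mul_self, mul_one, hs, ht1 rfl]
    · rw [hp a b (Or.inr ⟨h, Or.inl ⟨rfl, rfl⟩⟩), ht h]
  obtain ⟨w', s', hw', hs', h₁, h₂⟩ := exists_resample w s hw hs v
    (fun i => k₀ + k₁ * spin (s i a) + k₂ * spin (s i b) + k₃ * (spin (s i a) * spin (s i b)))
    (fun i => hκ _ _)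
  have hlin : ∀ c₀ c₁ c₂ c₃ : ℝ, ∑ i, w i * (c₀ + c₁ * spin (s i a) + c₂ * spin (s i b) +
      c₃ * (spin (s i a) * spin (s i b))) = c₀ + c₁ * m a + c₂ * m b + c₃ * t := by
    intro c₀ c₁ c₂ c₃
    rw [← hm a, ← hm b, ← hst]
    conv_rhs => rw [← mul_one c₀, ← hs]
    simp only [Finset.mul_sum, ← Finset.sum_add_distrib]
    exact Finset.sum_congr rfl fun i _ => by ring
  have hmean : ∑ i, w' i * spin (s' i v) = m v := by
    have := h₂ (fun _ => 1) (fun _ _ => rfl)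
    simp only [mul_one, hlin] at this
    rw [this, e₁]
  have hpa : ∑ i, w' i * (spin (s' i v) * spin (s' i a)) = e v a := by
    rw [h₂ (fun x => spin (x a)) (by intro x c; simp [hav]), ← e₂]
    refine Eq.trans (Finset.sum_congr rfl fun i _ => ?_)
      ((hlin k₁ k₀ k₃ k₂).trans (by ring))
    linear_combination (w i * (k₁ + k₃ * spin (s i b))) * spin_mul_self (s i a)
  have hpb : ∑ i, w' i * (spin (s' i v) * spin (s' i b)) = e v b := by
    rw [h₂ (fun x => spin (x b)) (by intro x c; simp [hbv]), ← e₃]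
    refine Eq.trans (Finset.sum_congr rfl fun i _ => ?_)
      ((hlin k₂ k₃ k₀ k₁).trans (by ring))
    linear_combination (w i * (k₂ + k₃ * spin (s i a))) * spin_mul_self (s i b)
  have hpv : ∀ x, G.Adj v x → ∑ i, w' i * (spin (s' i v) * spin (s' i x)) = e v x := by
    intro x hx
    rcases (hv x).1 hx with rfl | rfl
    · exact hpa
    · exact hpb
  refine ⟨⟨_, inferInstance, w', s', hw', hs', fun u => ?_, fun u x hux => ?_⟩⟩
  · by_cases huv : u = v
    · rw [huv, hmean]
    · rw [h₁ (fun x => spin (x u)) (by intro x c; simp [huv]), hm]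
  · by_cases huv : u = v
    · subst huv
      exact hpv x hux
    by_cases hxv : x = v
    · subst hxv
      rw [hsymm, ← hpv u hux.symm]
      exact Finset.sum_congr rfl fun i _ => by ring
    · rw [h₁ (fun y => spin (y u) * spin (y x)) (by intro y c; simp [huv, hxv]),
        hp u x (Or.inl ⟨hux, huv, hxv⟩), he u x hux]

/-- For a graph without `K₄` minor and without long induced cycles, the edge, triangle and
induced four-cycle inequalities describe the moments of distributions of binary states. -/
theorem exists_spinModel {V : Type} [Finite V] (N : ℕ) : ∀ (G : SimpleGraph V)
    (_ : {u | ∃ w, G.Adj u w}.ncard ≤ N) (_ : ¬ HasK4Minor G) (_ : InducedCyclesLe4 G)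
    (m : V → ℝ) (e : V → V → ℝ) (_ : ∀ u w, e u w = e w u) (_ : ∀ u, |m u| ≤ 1)
    (_ : ∀ u w, G.Adj u w → TriangleIneq (m u) (m w) (e u w))
    (_ : ∀ u w x, G.Adj u w → G.Adj w x → G.Adj u x →
      TriangleIneq (e u w) (e w x) (e u x))
    (_ : ∀ p q r s, IsInducedSquare G p q r s → |e p q + e q r| + |e r s - e s p| ≤ 2),
    Nonempty (SpinModel G m e) := by
  classical
  have := Fintype.ofFinite V
  induction N with
  | zero =>
    intro G hN _ _ m e _ hm _ _ _
    refine exists_model_of_edgeless (fun u w h => ?_) m e hm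
    have : {u | ∃ w, G.Adj u w} = ∅ := by
      rw [← Set.ncard_eq_zero (Set.toFinite _)]; omega
    exact Set.eq_empty_iff_forall_notMem.1 this u ⟨w, h⟩
  | succ N ih =>
    intro G hN hK hC m e hsymm hm hE hT hS
    by_cases hG : ∀ u w, ¬ G.Adj u w
    · exact exists_model_of_edgeless hG m e hm
    push Not at hG
    obtain ⟨x, y, hxy⟩ := hG
    obtain ⟨v, a, b, hv⟩ := exists_degree_le_two hK hxy
    obtain ⟨t, htab, htw, ht1, hte⟩ := exists_bypass_moment hK hsymm hE hT hS hv
    have hva : G.Adj v a := (hv a).2 (Or.inl rfl)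
    have hvb : G.Adj v b := (hv b).2 (Or.inr rfl)
    set e' : V → V → ℝ := fun u w => if (u = a ∧ w = b) ∨ (u = b ∧ w = a) then t else e u w
      with he'
    have he'ab : e' a b = t := if_pos (Or.inl ⟨rfl, rfl⟩)
    have hsymm' : ∀ u w, e' u w = e' w u := by
      intro u w
      simp only [he', hsymm u w]
      congr 1
      rw [eq_iff_iff]
      tauto
    have heq : ∀ u w, G.Adj u w → e' u w = e u w := by
      intro u w h
      simp only [he']
      split_ifs with hc
      · rcases hc with ⟨rfl, rfl⟩ | ⟨rfl, rfl⟩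
        · exact hte h
        · rw [hte h.symm, hsymm]
      · rfl
    have hcase : ∀ u w, (bypass G v a b).Adj u w →
        G.Adj u w ∨ (u = a ∧ w = b) ∨ (u = b ∧ w = a) := by
      rintro u w (h | h)
      · exact Or.inl h.1
      · exact Or.inr h.2
    have hE' : ∀ u w, (bypass G v a b).Adj u w → TriangleIneq (m u) (m w) (e' u w) := by
      intro u w h
      rcases hcase u w h with h | ⟨rfl, rfl⟩ | ⟨rfl, rfl⟩
      · rw [heq u w h]; exact hE u w h
      · rw [he'ab]; exact htab
      · rw [hsymm', he'ab]; exact htab.swap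
    have hnew : ∀ w, (bypass G v a b).Adj a w → (bypass G v a b).Adj b w →
        TriangleIneq (e' a w) (e' b w) (e' a b) := by
      intro w h1 h2
      have h1' : G.Adj a w := by
        rcases hcase a w h1 with h | ⟨-, rfl⟩ | ⟨-, rfl⟩
        · exact h
        · exact absurd h2 (SimpleGraph.irrefl _)
        · exact absurd h1 (SimpleGraph.irrefl _)
      have h2' : G.Adj b w := by
        rcases hcase b w h2 with h | ⟨-, rfl⟩ | ⟨-, rfl⟩
        · exact h
        · exact absurd h2 (SimpleGraph.irrefl _)
        · exact absurd h1 (SimpleGraph.irrefl _)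
      rw [heq a w h1', heq b w h2', he'ab]
      exact htw w h1' h2'
    have hT' : ∀ u w x, (bypass G v a b).Adj u w → (bypass G v a b).Adj w x →
        (bypass G v a b).Adj u x → TriangleIneq (e' u w) (e' w x) (e' u x) := by
      intro u w x h1 h2 h3
      rcases hcase u w h1 with g1 | ⟨rfl, rfl⟩ | ⟨rfl, rfl⟩
      · rcases hcase w x h2 with g2 | ⟨rfl, rfl⟩ | ⟨rfl, rfl⟩
        · rcases hcase u x h3 with g3 | ⟨rfl, rfl⟩ | ⟨rfl, rfl⟩
          · rw [heq _ _ g1, heq _ _ g2, heq _ _ g3]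
            exact hT u w x g1 g2 g3
          · rw [hsymm' w x]
            exact hnew w h1 h2.symm
          · rw [hsymm' w x, hsymm' u x]
            exact (hnew w h2.symm h1).swap
        · rw [hsymm' u w, hsymm' u x]
          exact (hnew u h1.symm h3.symm).rotate.rotate.swap
        · rw [hsymm' u w, hsymm' u x, hsymm' w x]
          exact (hnew u h3.symm h1.symm).rotate
      · exact (hnew x h3 h2).rotate.swap
      · rw [hsymm' u w]
        exact (hnew x h2 h3).rotate.rotate
    have hS' : ∀ p q r s, IsInducedSquare (bypass G v a b) p q r s →
        |e' p q + e' q r| + |e' r s - e' s p| ≤ 2 := by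
      intro p q r s h
      have h' := h.of_bypass hC hv
      rw [heq _ _ h'.1, heq _ _ h'.2.1, heq _ _ h'.2.2.1, heq _ _ h'.2.2.2.1]
      exact hS p q r s h'
    have hcard : {u | ∃ w, (bypass G v a b).Adj u w}.ncard ≤ N := by
      have hlt : {u | ∃ w, (bypass G v a b).Adj u w}.ncard < {u | ∃ w, G.Adj u w}.ncard := by
        refine Set.ncard_lt_ncard ⟨?_, fun hsub => ?_⟩ (Set.toFinite _)
        · rintro u ⟨w, hw⟩
          rcases hcase u w hw with h | ⟨rfl, -⟩ | ⟨rfl, -⟩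
          · exact ⟨w, h⟩
          · exact ⟨v, hva.symm⟩
          · exact ⟨v, hvb.symm⟩
        · obtain ⟨w, hw⟩ := hsub (show v ∈ {u | ∃ w, G.Adj u w} from ⟨a, hva⟩)
          exact (bypass_adj_ne hv hw).1 rfl
      omega
    obtain ⟨M⟩ := ih (bypass G v a b) hcard (fun h => hK (hasK4Minor_of_bypass hv h))
      (inducedCyclesLe4_bypass hC hv) m e' hsymm' hm hE' hT' hS'
    refine SpinModel.extend hsymm hv ?_ ?_ htab ?_ heq (fun _ => he'ab) ht1 M
    · rw [hsymm]; exact hE a v hva.symm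
    · rw [hsymm]; exact hE b v hvb.symm
    · rw [hsymm v a, hsymm v b]; exact htw v hva.symm hvb.symm


lemma exists_int_of_mem_closure {X E : Type*} {a : X → E → ℝ} (h01 : ∀ x e, a x e = 0 ∨ a x e = 1)
    {z : E → ℝ} (hz : z ∈ AddSubgroup.closure (Set.range a)) (e : E) : ∃ n : ℤ, z e = n := by
  induction hz using AddSubgroup.closure_induction with
  | mem z hz =>
    obtain ⟨x, rfl⟩ := hz
    rcases h01 x e with h | h
    · exact ⟨0, by simp [h]⟩
    · exact ⟨1, by simp [h]⟩
  | zero => exact ⟨0, by simp⟩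
  | add y z _ _ hy hz =>
    obtain ⟨p, hp⟩ := hy
    obtain ⟨q, hq⟩ := hz
    exact ⟨p + q, by simp [hp, hq]⟩
  | neg z _ hz =>
    obtain ⟨p, hp⟩ := hz
    exact ⟨-p, by simp [hp]⟩

section AffineCombinations

variable {X E : Type*} [Fintype X]

lemma affineMap_sum_smul {F : Type*} [AddCommGroup F] [Module ℝ F] (φ : (E → ℝ) →ᵃ[ℝ] F)
    (a : X → E → ℝ) (c : X → ℝ) (hc : ∑ x, c x = 1) :
    φ (∑ x, c x • a x) = ∑ x, c x • φ (a x) := by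
  rw [← Finset.affineCombination_eq_linear_combination _ _ _ hc,
    Finset.map_affineCombination _ _ _ hc, Finset.affineCombination_eq_linear_combination _ _ _ hc]
  rfl

lemma mem_affineSpan_range_iff (a : X → E → ℝ) (z : E → ℝ) :
    z ∈ affineSpan ℝ (Set.range a) ↔ ∃ c : X → ℝ, ∑ x, c x = 1 ∧ ∑ x, c x • a x = z := by
  constructor
  · intro h
    obtain ⟨c, hc, rfl⟩ := eq_affineCombination_of_mem_affineSpan_of_fintype h
    exact ⟨c, hc, (Finset.affineCombination_eq_linear_combination _ _ _ hc).symm⟩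
  · rintro ⟨c, hc, rfl⟩
    rw [← Finset.affineCombination_eq_linear_combination _ _ _ hc]
    exact affineCombination_mem_affineSpan hc _

lemma mem_convexHull_range_iff (a : X → E → ℝ) (z : E → ℝ) :
    z ∈ convexHull ℝ (Set.range a) ↔
      ∃ c : X → ℝ, (∀ x, 0 ≤ c x) ∧ ∑ x, c x = 1 ∧ ∑ x, c x • a x = z := by
  classical
  constructor
  · rw [convexHull_range_eq_exists_affineCombination]
    rintro ⟨s, w, hw, hs, rfl⟩
    refine ⟨fun x => if x ∈ s then w x else 0, fun x => ?_, ?_, ?_⟩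
    · dsimp only
      split_ifs with h
      · exact hw x h
      · exact le_rfl
    · simpa using hs
    · rw [Finset.affineCombination_eq_linear_combination _ _ _ hs]
      simp [ite_smul]
  · rintro ⟨c, hc, hs, rfl⟩
    exact (convex_convexHull ℝ _).sum_mem (fun x _ => hc x) hs
      fun x _ => subset_convexHull ℝ _ ⟨x, rfl⟩

/-- A `0/1` point of the convex hull of `0/1` points is one of these points. -/
lemma eq_of_mem_convexHull_of_zeroOne {a : X → E → ℝ} (h01 : ∀ x e, a x e = 0 ∨ a x e = 1)
    {z : E → ℝ} (hz : z ∈ convexHull ℝ (Set.range a)) (hz01 : ∀ e, z e = 0 ∨ z e = 1) :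
    ∃ x, a x = z := by
  obtain ⟨c, hc, hs, rfl⟩ := (mem_convexHull_range_iff a _).1 hz
  obtain ⟨x, hx⟩ : ∃ x, 0 < c x := by
    by_contra! h
    have : ∑ x, c x ≤ 0 := Finset.sum_nonpos fun x _ => h x
    linarith
  refine ⟨x, funext fun e => ?_⟩
  have happ : (∑ y, c y • a y) e = ∑ y, c y * a y e := by simp [Finset.sum_apply]
  have ha : ∀ y, 0 ≤ a y e ∧ a y e ≤ 1 := fun y => by
    rcases h01 y e with h | h <;> rw [h] <;> norm_num
  rcases hz01 e with h | h
  · rw [h]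
    rw [happ, Finset.sum_eq_zero_iff_of_nonneg (fun y _ => mul_nonneg (hc y) (ha y).1)] at h
    exact (mul_eq_zero.1 (h x (Finset.mem_univ x))).resolve_left hx.ne'
  · rw [h]
    have h' : ∑ y, c y * (1 - a y e) = 0 := by
      rw [happ] at h
      simp only [mul_sub, mul_one, Finset.sum_sub_distrib, h, hs, sub_self]
    rw [Finset.sum_eq_zero_iff_of_nonneg
      (fun y _ => mul_nonneg (hc y) (sub_nonneg.2 (ha y).2))] at h'
    have := (mul_eq_zero.1 (h' x (Finset.mem_univ x))).resolve_left hx.ne'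
    linarith

/-- A `0/1` polytope is compressed as soon as it is cut out of its affine span by the
inequalities `0 ≤ φ` for the affine functionals `φ` with values `0, 1` on the vertices. -/
lemma isCompressed_of_twoLevel (a : X → E → ℝ) (h01 : ∀ x e, a x e = 0 ∨ a x e = 1)
    (h : ∀ z ∈ affineSpan ℝ (Set.range a),
      (∀ φ : (E → ℝ) →ᵃ[ℝ] ℝ, (∀ x, φ (a x) = 0 ∨ φ (a x) = 1) → 0 ≤ φ z) →
      z ∈ convexHull ℝ (Set.range a)) : IsCompressed (Set.range a) := by
  classical
  have heqv := Fintype.equivFin (X → Fin 2)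
  set N := Fintype.card (X → Fin 2)
  have key : ∀ g : X → Fin 2, ∃ φ : (E → ℝ) →ᵃ[ℝ] ℝ, (∀ x, φ (a x) = 0 ∨ φ (a x) = 1) ∧
      ((∃ ψ : (E → ℝ) →ᵃ[ℝ] ℝ, ∀ x, ψ (a x) = (g x : ℕ)) → ∀ x, φ (a x) = (g x : ℕ)) := by
    intro g
    by_cases hg : ∃ ψ : (E → ℝ) →ᵃ[ℝ] ℝ, ∀ x, ψ (a x) = (g x : ℕ)
    · obtain ⟨ψ, hψ⟩ := hg
      refine ⟨ψ, fun x => ?_, fun _ => hψ⟩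
      rw [hψ]
      have := (g x).isLt
      interval_cases (g x : ℕ) <;> simp
    · exact ⟨0, fun x => Or.inl rfl, fun hg' => absurd hg' hg⟩
  choose φ hφ01 hφ using key
  have hall : ∀ ψ : (E → ℝ) →ᵃ[ℝ] ℝ, (∀ x, ψ (a x) = 0 ∨ ψ (a x) = 1) →
      ∃ g, ∀ z ∈ affineSpan ℝ (Set.range a), φ g z = ψ z := by
    intro ψ hψ
    refine ⟨fun x => if ψ (a x) = 0 then 0 else 1, fun z hz => ?_⟩
    obtain ⟨c, hc, rfl⟩ := (mem_affineSpan_range_iff a z).1 hz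
    rw [affineMap_sum_smul _ _ _ hc, affineMap_sum_smul _ _ _ hc]
    have hv : ∀ x, ψ (a x) = ((if ψ (a x) = 0 then (0 : Fin 2) else 1 : Fin 2) : ℕ) := by
      intro x
      rcases hψ x with h | h <;> simp [h]
    refine Finset.sum_congr rfl fun x _ => ?_
    rw [hφ _ ⟨ψ, hv⟩ x, ← hv x]
  have hsub : convexHull ℝ (Set.range a) ⊆ affineSpan ℝ (Set.range a) :=
    convexHull_subset_affineSpan _
  let π : (E → ℝ) →ᵃ[ℝ] (Fin N → ℝ) := AffineMap.pi fun i => φ (heqv.symm i)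
  have hπ : ∀ z i, π z i = φ (heqv.symm i) z := fun _ _ => rfl
  have hvertex : ∀ x, π (a x) ∈ zeroOneSet N := fun x i => hφ01 _ x
  refine ⟨N, π, ?_, ?_, ?_⟩
  · intro y hy z hz hyz
    ext e
    obtain ⟨g, hg⟩ := hall (LinearMap.proj e : (E → ℝ) →ₗ[ℝ] ℝ).toAffineMap fun x => h01 x e
    have h1 := hg y (hsub hy)
    have h2 := hg z (hsub hz)
    have h3 := congrFun hyz (heqv g)
    rw [hπ, hπ, Equiv.symm_apply_apply, h1, h2] at h3
    exact h3
  · rintro z ⟨hz, hz'⟩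
    have hbox : ∀ e, 0 ≤ z e ∧ z e ≤ 1 := by
      intro e
      obtain ⟨c, hc, hs, rfl⟩ := (mem_convexHull_range_iff a z).1 hz
      have ha : ∀ y, 0 ≤ a y e ∧ a y e ≤ 1 := fun y => by
        rcases h01 y e with h | h <;> rw [h] <;> norm_num
      have happ : (∑ y, c y • a y) e = ∑ y, c y * a y e := by simp [Finset.sum_apply]
      rw [happ]
      refine ⟨Finset.sum_nonneg fun y _ => mul_nonneg (hc y) (ha y).1, ?_⟩
      rw [← hs]
      exact Finset.sum_le_sum fun y _ => mul_le_of_le_one_right (hc y) (ha y).2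
    have hz01 : ∀ e, z e = 0 ∨ z e = 1 := by
      intro e
      obtain ⟨p, hp⟩ := exists_int_of_mem_closure h01 hz' e
      obtain ⟨h1, h2⟩ := hbox e
      rw [hp] at h1 h2 ⊢
      have h1' : 0 ≤ p := by exact_mod_cast h1
      have h2' : p ≤ 1 := by exact_mod_cast h2
      interval_cases p <;> simp
    obtain ⟨x, rfl⟩ := eq_of_mem_convexHull_of_zeroOne h01 hz hz01
    exact hvertex x
  · have hcube : Convex ℝ (stdCube N) := by
      have : stdCube N = Set.Icc 0 1 := by
        ext x
        simp [stdCube, Set.mem_Icc, Pi.le_def, forall_and]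
      rw [this]
      exact convex_Icc _ _
    refine Set.Subset.antisymm ?_ ?_
    · refine Set.subset_inter ?_ (subset_affineSpan ℝ _)
      rw [AffineMap.image_convexHull]
      refine convexHull_min ?_ hcube
      rintro _ ⟨_, ⟨x, rfl⟩, rfl⟩ i
      rcases hvertex x i with h | h <;> rw [h] <;> simp
    · rintro y ⟨hy, hy'⟩
      rw [← AffineSubspace.map_span, affineSpan_convexHull] at hy'
      obtain ⟨z, hz, rfl⟩ := hy'
      refine ⟨z, h z hz fun ψ hψ => ?_, rfl⟩
      obtain ⟨g, hg⟩ := hall ψ hψ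
      rw [← hg z hz]
      have := (hy (heqv g)).1
      rwa [hπ, Equiv.symm_apply_apply] at this

end AffineCombinations

/-- The function `f` on the index set of the points `a x` extends to an affine functional. -/
def IsAffineOn {X E : Type*} (a : X → E → ℝ) (f : X → ℝ) : Prop :=
  ∃ φ : (E → ℝ) →ᵃ[ℝ] ℝ, ∀ x, φ (a x) = f x

namespace IsAffineOn

variable {X E : Type*} {a : X → E → ℝ} {f g : X → ℝ}

lemma const (t : ℝ) : IsAffineOn a fun _ => t := ⟨AffineMap.const ℝ _ t, fun _ => rfl⟩

lemma coord (i : E) : IsAffineOn a fun x => a x i :=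
  ⟨(LinearMap.proj i : (E → ℝ) →ₗ[ℝ] ℝ).toAffineMap, fun _ => rfl⟩

lemma add (hf : IsAffineOn a f) (hg : IsAffineOn a g) : IsAffineOn a fun x => f x + g x := by
  obtain ⟨φ, hφ⟩ := hf
  obtain ⟨ψ, hψ⟩ := hg
  exact ⟨φ + ψ, fun x => by simp [hφ, hψ]⟩

lemma const_mul (t : ℝ) (hf : IsAffineOn a f) : IsAffineOn a fun x => t * f x := by
  obtain ⟨φ, hφ⟩ := hf
  exact ⟨t • φ, fun x => by simp [hφ]⟩

lemma sum {ι : Type*} (s : Finset ι) {F : ι → X → ℝ} (h : ∀ i ∈ s, IsAffineOn a (F i)) :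
    IsAffineOn a fun x => ∑ i ∈ s, F i x := by
  classical
  induction s using Finset.induction_on with
  | empty => simpa using const 0
  | insert i s hi ih =>
    simp only [Finset.sum_insert hi]
    exact (h i (Finset.mem_insert_self i s)).add
      (ih fun j hj => h j (Finset.mem_insert_of_mem hj))

end IsAffineOn

section Marginals

variable {V : Type*} {𝓕 : Finset (Finset V)}

/-- Functions of the two variables of an edge are affine in the marginals. -/
lemma isAffineOn_pair [DecidableEq V] {u v : V} (huv : ({u, v} : Finset V) ∈ 𝓕)
    (h : Fin 2 → Fin 2 → ℝ) :
    IsAffineOn (margVec 𝓕 (fun _ => 2)) fun x => h (x u) (x v) := by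
  let u' : {a // a ∈ ({u, v} : Finset V)} := ⟨u, by simp⟩
  let v' : {a // a ∈ ({u, v} : Finset V)} := ⟨v, by simp⟩
  have hsum : IsAffineOn (margVec 𝓕 (fun _ => 2)) fun x =>
      ∑ y : {a // a ∈ ({u, v} : Finset V)} → Fin 2,
        h (y u') (y v') * margVec 𝓕 (fun _ => 2) x ⟨⟨_, huv⟩, y⟩ :=
    IsAffineOn.sum _ fun y _ => (IsAffineOn.coord (E := MargIndex 𝓕 fun _ => 2)
      ⟨⟨_, huv⟩, y⟩).const_mul _
  refine (congrArg _ (funext fun x => ?_)).mp hsum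
  rw [Finset.sum_eq_single fun i => x i.1]
  · simp [margVec, u', v']
  · intro y _ hy
    have : ¬ ∀ i : {a // a ∈ ({u, v} : Finset V)}, x i.1 = y i :=
      fun H => hy (funext fun i => (H i).symm)
    simp only [margVec]
    rw [if_neg this, mul_zero]
  · simp

lemma spin_eq_or (c : Fin 2) : spin c = 1 ∨ spin c = -1 := by
  fin_cases c <;> simp

lemma ite_eq_spin (c c' : Fin 2) :
    (if c = c' then (1 : ℝ) else 0) = (1 + spin c' * spin c) / 2 := by
  fin_cases c <;> fin_cases c' <;> norm_num [spin]

lemma margVec_eq_spin {G : SimpleGraph V} [DecidableEq V]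
    (h𝓕 : ∀ F, F ∈ 𝓕 ↔ ∃ u v, G.Adj u v ∧ F = {u, v}) (p : MargIndex 𝓕 (fun _ => 2)) :
    ∃ u v, G.Adj u v ∧ ∃ α β : Fin 2, ∀ x, margVec 𝓕 (fun _ => 2) x p =
      (1 + spin α * spin (x u)) / 2 * ((1 + spin β * spin (x v)) / 2) := by
  obtain ⟨⟨F, hF⟩, y⟩ := p
  obtain ⟨u, v, huv, rfl⟩ := (h𝓕 F).1 hF
  refine ⟨u, v, huv, y ⟨u, by simp⟩, y ⟨v, by simp⟩, fun x => ?_⟩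
  rw [← ite_eq_spin, ← ite_eq_spin, ite_zero_mul_ite_zero, mul_one]
  refine if_congr ⟨fun H => ⟨H ⟨u, _⟩, H ⟨v, _⟩⟩, ?_⟩ rfl rfl
  rintro ⟨h1, h2⟩ ⟨i, hi⟩
  rcases Finset.mem_insert.1 hi with rfl | hi'
  · exact h1
  · obtain rfl := Finset.mem_singleton.1 hi'
    exact h2

lemma margVec_zero_or_one (x : V → Fin 2) (p : MargIndex 𝓕 (fun _ => 2)) :
    margVec 𝓕 (fun _ => 2) x p = 0 ∨ margVec 𝓕 (fun _ => 2) x p = 1 := by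
  simp only [margVec]
  split_ifs <;> simp

end Marginals

section Moments

variable {X E : Type*} [Fintype X] {a : X → E → ℝ} {c : X → ℝ}

/-- `c` is a signed probability distribution on the points `a x` whose barycentre satisfies all
inequalities given by affine functionals with values `0, 1`. -/
def TwoLevelPositive (a : X → E → ℝ) (c : X → ℝ) : Prop :=
  ∑ x, c x = 1 ∧ ∀ f : X → ℝ, IsAffineOn a f → (∀ x, f x = 0 ∨ f x = 1) → 0 ≤ ∑ x, c x * f x

lemma TwoLevelPositive.four (hc : TwoLevelPositive a c) (k₀ k₁ k₂ k₃ k₄ : ℝ)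
    {f₁ f₂ f₃ f₄ : X → ℝ} (h₁ : IsAffineOn a f₁) (h₂ : IsAffineOn a f₂) (h₃ : IsAffineOn a f₃)
    (h₄ : IsAffineOn a f₄)
    (h : ∀ x, k₀ + k₁ * f₁ x + k₂ * f₂ x + k₃ * f₃ x + k₄ * f₄ x = 0 ∨
      k₀ + k₁ * f₁ x + k₂ * f₂ x + k₃ * f₃ x + k₄ * f₄ x = 4) :
    0 ≤ k₀ + k₁ * (∑ x, c x * f₁ x) + k₂ * (∑ x, c x * f₂ x) + k₃ * (∑ x, c x * f₃ x) +
      k₄ * ∑ x, c x * f₄ x := by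
  have h0 := hc.2 _ (((((IsAffineOn.const k₀).add (h₁.const_mul k₁)).add (h₂.const_mul k₂)).add
    (h₃.const_mul k₃)).add (h₄.const_mul k₄) |>.const_mul (1 / 4)) fun x => by
      rcases h x with h | h <;> rw [h] <;> norm_num
  have : ∑ x, c x * (1 / 4 * (k₀ + k₁ * f₁ x + k₂ * f₂ x + k₃ * f₃ x + k₄ * f₄ x)) =
      1 / 4 * (k₀ * (∑ x, c x) + k₁ * (∑ x, c x * f₁ x) + k₂ * (∑ x, c x * f₂ x) +
        k₃ * (∑ x, c x * f₃ x) + k₄ * ∑ x, c x * f₄ x) := by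
    simp only [Finset.mul_sum, ← Finset.sum_add_distrib]
    exact Finset.sum_congr rfl fun x _ => by ring
  rw [this, hc.1] at h0
  linarith

lemma TwoLevelPositive.triangleIneq (hc : TwoLevelPositive a c) {f₁ f₂ f₃ : X → ℝ}
    (h₁ : IsAffineOn a f₁) (h₂ : IsAffineOn a f₂) (h₃ : IsAffineOn a f₃)
    (hf₁ : ∀ x, f₁ x = 1 ∨ f₁ x = -1) (hf₂ : ∀ x, f₂ x = 1 ∨ f₂ x = -1)
    (hf₃ : ∀ x, f₃ x = f₁ x * f₂ x) :
    TriangleIneq (∑ x, c x * f₁ x) (∑ x, c x * f₂ x) (∑ x, c x * f₃ x) := by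
  rw [triangleIneq_iff]
  have h0 : IsAffineOn a fun _ => 0 := IsAffineOn.const 0
  refine ⟨?_, ?_, ?_, ?_⟩
  · have := hc.four 1 1 1 1 0 h₁ h₂ h₃ h0 fun x => by
      rcases hf₁ x with h | h <;> rcases hf₂ x with h' | h' <;> rw [hf₃, h, h'] <;> norm_num
    linarith
  · have := hc.four 1 1 (-1) (-1) 0 h₁ h₂ h₃ h0 fun x => by
      rcases hf₁ x with h | h <;> rcases hf₂ x with h' | h' <;> rw [hf₃, h, h'] <;> norm_num
    linarith
  · have := hc.four 1 (-1) 1 (-1) 0 h₁ h₂ h₃ h0 fun x => by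
      rcases hf₁ x with h | h <;> rcases hf₂ x with h' | h' <;> rw [hf₃, h, h'] <;> norm_num
    linarith
  · have := hc.four 1 (-1) (-1) 1 0 h₁ h₂ h₃ h0 fun x => by
      rcases hf₁ x with h | h <;> rcases hf₂ x with h' | h' <;> rw [hf₃, h, h'] <;> norm_num
    linarith

lemma TwoLevelPositive.squareIneq (hc : TwoLevelPositive a c) {f₁ f₂ f₃ f₄ : X → ℝ}
    (h₁ : IsAffineOn a f₁) (h₂ : IsAffineOn a f₂) (h₃ : IsAffineOn a f₃) (h₄ : IsAffineOn a f₄)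
    (hf₁ : ∀ x, f₁ x = 1 ∨ f₁ x = -1) (hf₂ : ∀ x, f₂ x = 1 ∨ f₂ x = -1)
    (hf₃ : ∀ x, f₃ x = 1 ∨ f₃ x = -1) (hf₄ : ∀ x, f₄ x = f₁ x * f₂ x * f₃ x) :
    |∑ x, c x * f₁ x + ∑ x, c x * f₂ x| + |∑ x, c x * f₃ x - ∑ x, c x * f₄ x| ≤ 2 := by
  have key : ∀ σ τ : ℝ, (σ = 1 ∨ σ = -1) → (τ = 1 ∨ τ = -1) →
      0 ≤ 2 + σ * (∑ x, c x * f₁ x) + σ * (∑ x, c x * f₂ x) + τ * (∑ x, c x * f₃ x) +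
        -τ * ∑ x, c x * f₄ x := by
    intro σ τ hσ hτ
    refine hc.four 2 σ σ τ (-τ) h₁ h₂ h₃ h₄ fun x => ?_
    rcases hσ with rfl | rfl <;> rcases hτ with rfl | rfl <;>
    rcases hf₁ x with h | h <;> rcases hf₂ x with h' | h' <;> rcases hf₃ x with h'' | h'' <;>
      rw [hf₄, h, h', h''] <;> norm_num
  have k1 := key 1 1 (.inl rfl) (.inl rfl)
  have k2 := key 1 (-1) (.inl rfl) (.inr rfl)
  have k3 := key (-1) 1 (.inr rfl) (.inl rfl)
  have k4 := key (-1) (-1) (.inr rfl) (.inr rfl)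
  rcases abs_cases (∑ x, c x * f₁ x + ∑ x, c x * f₂ x) with ⟨h, _⟩ | ⟨h, _⟩ <;>
  rcases abs_cases (∑ x, c x * f₃ x - ∑ x, c x * f₄ x) with ⟨h', _⟩ | ⟨h', _⟩ <;>
    rw [h, h'] <;> linarith

end Moments

theorem isCompressed_of_noK4Minor_of_inducedCyclesLe4 {V : Type} [Fintype V] [DecidableEq V]
    {G : SimpleGraph V} {𝓕 : Finset (Finset V)}
    (h𝓕 : ∀ F, F ∈ 𝓕 ↔ ∃ u v, G.Adj u v ∧ F = {u, v})
    (hK : ¬ HasK4Minor G) (hC : InducedCyclesLe4 G) :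
    IsCompressed (Set.range (margVec 𝓕 (fun _ => 2))) := by
  classical
  refine isCompressed_of_twoLevel _ margVec_zero_or_one fun z hz hz' => ?_
  obtain ⟨c, hc1, rfl⟩ := (mem_affineSpan_range_iff _ z).1 hz
  have hc : TwoLevelPositive (margVec 𝓕 (fun _ => 2)) c := by
    refine ⟨hc1, ?_⟩
    rintro f ⟨φ, hφ⟩ hf
    have := hz' φ fun x => by rw [hφ]; exact hf x
    rw [affineMap_sum_smul _ _ _ hc1] at this
    simpa only [hφ, smul_eq_mul] using this
  have hpair : ∀ {u v}, G.Adj u v → ∀ h : Fin 2 → Fin 2 → ℝ,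
      IsAffineOn (margVec 𝓕 (fun _ => 2)) fun x => h (x u) (x v) :=
    fun huv h => isAffineOn_pair ((h𝓕 _).2 ⟨_, _, huv, rfl⟩) h
  have hs : ∀ t : Fin 2, spin t = 1 ∨ spin t = -1 := spin_eq_or
  have hss : ∀ t t' : Fin 2, spin t * spin t' = 1 ∨ spin t * spin t' = -1 := by
    intro t t'
    rcases hs t with h | h <;> rcases hs t' with h' | h' <;> rw [h, h'] <;> norm_num
  set m : V → ℝ := fun u => if ∃ w, G.Adj u w then ∑ x, c x * spin (x u) else 0 with hm
  set e : V → V → ℝ := fun u w => ∑ x, c x * (spin (x u) * spin (x w)) with he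
  have hmE : ∀ {u w}, G.Adj u w → m u = ∑ x, c x * spin (x u) := fun h => if_pos ⟨_, h⟩
  have hedge : ∀ u w, G.Adj u w → TriangleIneq (m u) (m w) (e u w) := by
    intro u w h
    rw [hmE h, hmE h.symm]
    exact hc.triangleIneq (hpair h fun s _ => spin s) (hpair h fun _ s => spin s)
      (hpair h fun s t => spin s * spin t) (fun x => hs _) (fun x => hs _) fun x => rfl
  have hm1 : ∀ u, |m u| ≤ 1 := by
    intro u
    by_cases h : ∃ w, G.Adj u w
    · obtain ⟨w, h⟩ := h
      exact (hedge u w h).rotate.abs_le_one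
    · simp [hm, h]
  obtain ⟨S⟩ := exists_spinModel _ G le_rfl hK hC m e
    (fun u w => Finset.sum_congr rfl fun x _ => by ring) hm1 hedge
    (fun u w x h1 h2 h3 => hc.triangleIneq (hpair h1 fun s t => spin s * spin t)
      (hpair h2 fun s t => spin s * spin t) (hpair h3 fun s t => spin s * spin t)
      (fun _ => hss _ _) (fun _ => hss _ _) fun y => by
        linear_combination (-spin (y u) * spin (y x)) * spin_mul_self (y w))
    (fun p q r s h => hc.squareIneq (hpair h.1 fun s t => spin s * spin t)
      (hpair h.2.1 fun s t => spin s * spin t) (hpair h.2.2.1 fun s t => spin s * spin t)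
      (hpair h.2.2.2.1 fun s t => spin s * spin t)
      (fun _ => hss _ _) (fun _ => hss _ _) (fun _ => hss _ _) fun y => by
        linear_combination (-spin (y p) * spin (y s) * spin (y r) * spin (y r)) *
          spin_mul_self (y q) - (spin (y p) * spin (y s)) * spin_mul_self (y r))
  let _ := S.fintype
  have hmom : ∀ {Y : Type} [Fintype Y] (w : Y → ℝ) (st : Y → V → Fin 2) (α β : Fin 2) (u v : V),
      ∑ y, w y * ((1 + spin α * spin (st y u)) / 2 * ((1 + spin β * spin (st y v)) / 2)) =
      1 / 4 * (∑ y, w y + spin α * ∑ y, w y * spin (st y u) + spin β * ∑ y, w y * spin (st y v) +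
        spin α * spin β * ∑ y, w y * (spin (st y u) * spin (st y v))) := by
    intro Y _ w st α β u v
    simp only [Finset.mul_sum, ← Finset.sum_add_distrib]
    exact Finset.sum_congr rfl fun x _ => by ring
  have heq : ∑ x, c x • margVec 𝓕 (fun _ => 2) x =
      ∑ i, S.weight i • margVec 𝓕 (fun _ => 2) (S.state i) := by
    funext p
    obtain ⟨u, v, huv, α, β, hp⟩ := margVec_eq_spin h𝓕 p
    simp only [Finset.sum_apply, Pi.smul_apply, smul_eq_mul, hp]
    rw [hmom S.weight, hmom c (fun x => x), S.sum_weight, S.mean, S.mean, S.pair u v huv, hc1,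
      hmE huv, hmE huv.symm]
  rw [heq]
  exact (convex_convexHull ℝ _).sum_mem (fun i _ => S.weight_nonneg i) S.sum_weight
    fun i _ => subset_convexHull ℝ _ ⟨S.state i, rfl⟩

lemma affineMap_sum_smul_eq_zero {K E : Type*} [Fintype K] (φ : (E → ℝ) →ᵃ[ℝ] ℝ)
    {b : K → E → ℝ} {c : K → ℝ} (hc : ∑ k, c k = 0) (hcb : ∑ k, c k • b k = 0) :
    ∑ k, c k * φ (b k) = 0 := by
  have hφ : ∀ z, φ z = φ.linear z + φ 0 := fun z => congrFun φ.decomp z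
  have h := congrArg φ.linear hcb
  rw [map_sum, map_zero] at h
  simp only [map_smul, smul_eq_mul] at h
  have hsplit : ∑ k, c k * φ (b k) = ∑ k, c k * φ.linear (b k) + (∑ k, c k) * φ 0 := by
    rw [Finset.sum_mul, ← Finset.sum_add_distrib]
    exact Finset.sum_congr rfl fun k _ => by rw [hφ (b k)]; ring
  rw [hsplit, h, hc, zero_mul, add_zero]

/-- A `0/1`-valued solution `ψ` of a linear relation that is constant at all indices but `q` and
`r` takes the same constant value at `q`; hence one may move from a barycentre `w` of the other
indices a little away from `q` without violating `0 ≤ ψ`. -/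
lemma nonneg_of_relation {K : Type*} [Fintype K] {c w : K → ℝ} {q r : K} (hqr : q ≠ r)
    (hcq : c q ≠ 0) (hcqr : c q + c r ≠ 0) {ε : ℝ} (hε : 0 < ε)
    (hw0 : ∀ k, 0 ≤ w k) (hwε : ∀ k, k ≠ q → k ≠ r → w k = ε) {ψ : K → ℝ}
    (hψ : ∀ k, ψ k = 0 ∨ ψ k = 1) (hcψ : ∑ k, c k * ψ k = 0) :
    0 ≤ (1 + ε) * (∑ k, w k * ψ k) - ε * ψ q := by
  classical
  have hψ0 : ∀ k, 0 ≤ ψ k := fun k => by rcases hψ k with h | h <;> rw [h]; norm_num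
  have hP : 0 ≤ ∑ k, w k * ψ k := Finset.sum_nonneg fun k _ => mul_nonneg (hw0 k) (hψ0 k)
  by_cases h : ∃ k, k ≠ q ∧ k ≠ r ∧ ψ k = 1
  · obtain ⟨k, hkq, hkr, hk⟩ := h
    have h1 : w k * ψ k ≤ ∑ k, w k * ψ k :=
      Finset.single_le_sum (fun k _ => mul_nonneg (hw0 k) (hψ0 k)) (Finset.mem_univ k)
    rw [hk, hwε k hkq hkr] at h1
    rcases hψ q with h | h <;> rw [h] <;> nlinarith
  · push Not at h
    have hroot : ∀ k, k ≠ q → k ≠ r → ψ k = 0 := fun k h1 h2 => (hψ k).resolve_right (h k h1 h2)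
    have hrel : c q * ψ q + c r * ψ r = 0 := by
      rw [← hcψ, ← Finset.sum_subset (Finset.subset_univ {q, r}), Finset.sum_pair hqr]
      intro k _ hk
      simp only [Finset.mem_insert, Finset.mem_singleton, not_or] at hk
      rw [hroot k hk.1 hk.2, mul_zero]
    have hq : ψ q = 0 := by
      rcases hψ q with h | h
      · exact h
      · rcases hψ r with h' | h' <;> rw [h, h'] at hrel
        · exact absurd (by linarith) hcq
        · exact absurd (by linarith) hcqr
    rw [hq]
    nlinarith

/-- Obstruction to compressedness: an affine relation between points of `A` that all lie on a
face of the polytope, except for two points whose coefficients do not cancel. -/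
lemma not_isCompressed_of_relation {X E K : Type*} [Fintype K] {a : X → E → ℝ} (s : K → X)
    {c : K → ℝ} (hc : ∑ k, c k = 0) (hca : ∑ k, c k • a (s k) = 0) {q r : K} (hqr : q ≠ r)
    (hcq : c q ≠ 0) (hcqr : c q + c r ≠ 0) {ℓ : (E → ℝ) →ᵃ[ℝ] ℝ}
    (hℓ : ∀ x, 0 ≤ ℓ (a x)) (hq : 0 < ℓ (a (s q)))
    (hroot : ∀ k, k ≠ q → k ≠ r → ℓ (a (s k)) = 0) (hex : ∃ k, k ≠ q ∧ k ≠ r) :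
    ¬ IsCompressed (Set.range a) := by
  classical
  rintro ⟨N, π, hinj, h01, himg⟩
  set P := convexHull ℝ (Set.range a) with hP
  have haP : ∀ x, a x ∈ P := fun x => subset_convexHull ℝ _ ⟨x, rfl⟩
  have hπa : ∀ x i, π (a x) i = 0 ∨ π (a x) i = 1 := fun x =>
    h01 _ ⟨haP x, AddSubgroup.subset_closure ⟨x, rfl⟩⟩
  have hPconv : Convex ℝ P := convex_convexHull ℝ _
  set R : Finset K := Finset.univ.filter fun k => k ≠ q ∧ k ≠ r with hR
  have hRpos : 0 < (R.card : ℝ) := by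
    obtain ⟨k, hk⟩ := hex
    exact_mod_cast Finset.card_pos.2 ⟨k, by simpa [hR] using hk⟩
  set ε : ℝ := 1 / R.card with hεdef
  have hε : 0 < ε := by positivity
  set w : K → ℝ := fun k => if k ≠ q ∧ k ≠ r then ε else 0 with hw
  have hw0 : ∀ k, 0 ≤ w k := fun k => by
    simp only [hw]
    split_ifs
    · exact hε.le
    · exact le_rfl
  have hwε : ∀ k, k ≠ q → k ≠ r → w k = ε := fun k h1 h2 => if_pos ⟨h1, h2⟩
  have hw1 : ∑ k, w k = 1 := by
    simp only [hw]
    rw [← Finset.sum_filter, Finset.sum_const, nsmul_eq_mul, hεdef]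
    exact mul_one_div_cancel hRpos.ne'
  clear_value ε w
  set p : E → ℝ := ∑ k, w k • a (s k) with hp
  have hpP : p ∈ P := hPconv.sum_mem (fun k _ => hw0 k) hw1 fun k _ => haP _
  have hℓp : ℓ p = 0 := by
    rw [hp, affineMap_sum_smul ℓ _ w hw1]
    refine Finset.sum_eq_zero fun k _ => ?_
    by_cases hk : k ≠ q ∧ k ≠ r
    · rw [hroot k hk.1 hk.2, smul_zero]
    · rw [hw]
      simp only
      rw [if_neg hk, zero_smul]
  have hπp : ∀ i, π p i = ∑ k, w k * π (a (s k)) i := fun i => by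
    rw [hp, affineMap_sum_smul π _ w hw1]
    simp [Finset.sum_apply]
  set y : Fin N → ℝ := AffineMap.lineMap (π (a (s q))) (π p) (1 + ε) with hy
  have hyi : ∀ i, y i = (1 + ε) * π p i - ε * π (a (s q)) i := fun i => by
    rw [hy, AffineMap.lineMap_apply_module]
    simp only [Pi.add_apply, Pi.smul_apply, smul_eq_mul]
    ring
  have hycube : y ∈ stdCube N := by
    intro i
    have hrel := affineMap_sum_smul_eq_zero
      (((LinearMap.proj i : (Fin N → ℝ) →ₗ[ℝ] ℝ).toAffineMap).comp π) hc hca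
    have hrel' : ∑ k, c k * π (a (s k)) i = 0 := hrel
    have h1 := nonneg_of_relation hqr hcq hcqr hε hw0 hwε
      (ψ := fun k => π (a (s k)) i) (fun k => hπa _ i) hrel'
    have h2 := nonneg_of_relation hqr hcq hcqr hε hw0 hwε
      (ψ := fun k => 1 - π (a (s k)) i) (fun k => by
        rcases hπa (s k) i with h | h <;> rw [h] <;> norm_num) (by
        simp only [mul_sub, mul_one, Finset.sum_sub_distrib, hc, hrel', sub_self])
    simp only [mul_sub, mul_one, Finset.sum_sub_distrib, hw1] at h2
    rw [hyi, hπp]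
    constructor <;> linarith
  have hyspan : y ∈ affineSpan ℝ (π '' P) :=
    AffineMap.lineMap_mem _ (subset_affineSpan ℝ _ ⟨_, haP _, rfl⟩)
      (subset_affineSpan ℝ _ ⟨_, hpP, rfl⟩)
  obtain ⟨z, hzP, hz⟩ : y ∈ π '' P := by
    rw [himg]
    exact ⟨hycube, hyspan⟩
  have hsum : 1 / (1 + ε) + ε / (1 + ε) = 1 := by field_simp
  set z' : E → ℝ := (1 / (1 + ε)) • z + (ε / (1 + ε)) • a (s q) with hz'
  have hz'P : z' ∈ P := hPconv hzP (haP _) (by positivity) (by positivity) hsum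
  have hz'p : z' = p := by
    refine hinj hz'P hpP ?_
    rw [hz', Convex.combo_affine_apply hsum, hz]
    funext i
    simp only [Pi.add_apply, Pi.smul_apply, smul_eq_mul]
    rw [hyi]
    field_simp
    ring
  have hℓz : 0 ≤ ℓ z := by
    have : P ⊆ ℓ ⁻¹' Set.Ici 0 := by
      refine convexHull_min ?_ ((convex_Ici 0).affine_preimage ℓ)
      rintro _ ⟨x, rfl⟩
      exact hℓ x
    exact this hzP
  have : 0 < ℓ z' := by
    rw [hz', Convex.combo_affine_apply hsum, smul_eq_mul, smul_eq_mul]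
    positivity
  rw [hz'p, hℓp] at this
  exact lt_irrefl _ this

/-- Combinatorial data on `m` binary variables with pair interactions: a nonnegative energy
function and an affine relation between states which have energy zero with two exceptions. -/
structure EnergyRelation (m : ℕ) where
  pairs : Finset (Fin m × Fin m)
  base : ℤ
  coupling : Fin 2 → Fin 2 → ℤ
  size : ℕ
  state : Fin size → Fin m → Fin 2
  coeff : Fin size → ℤ
  q : Fin size
  r : Fin size
  energy_nonneg : ∀ t : Fin m → Fin 2, 0 ≤ base + ∑ p ∈ pairs, coupling (t p.1) (t p.2)
  sum_coeff : ∑ k, coeff k = 0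
  relation : ∀ i j, (i = j ∨ (i, j) ∈ pairs) → ∀ α β,
    ∑ k, coeff k * (if state k i = α ∧ state k j = β then 1 else 0) = 0
  q_ne_r : q ≠ r
  coeff_q : coeff q ≠ 0
  coeff_qr : coeff q + coeff r ≠ 0
  energy_q : 0 < base + ∑ p ∈ pairs, coupling (state q p.1) (state q p.2)
  energy_root : ∀ k, k ≠ q → k ≠ r →
    base + ∑ p ∈ pairs, coupling (state k p.1) (state k p.2) = 0
  exists_root : ∃ k, k ≠ q ∧ k ≠ r

namespace EnergyRelation

variable {m : ℕ} (O : EnergyRelation m)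

lemma sum_coeff_mul {i j : Fin m} (hij : i = j ∨ (i, j) ∈ O.pairs) (h : Fin 2 → Fin 2 → ℝ) :
    ∑ k, (O.coeff k : ℝ) * h (O.state k i) (O.state k j) = 0 := by
  have hexp : ∀ x y : Fin 2, h x y = ∑ α, ∑ β, h α β * (if x = α ∧ y = β then 1 else 0) := by
    intro x y
    fin_cases x <;> fin_cases y <;> simp [Fin.sum_univ_two]
  simp only [hexp (O.state _ _) (O.state _ _), Finset.mul_sum]
  rw [Finset.sum_comm]
  refine Finset.sum_eq_zero fun α _ => ?_
  rw [Finset.sum_comm]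
  refine Finset.sum_eq_zero fun β _ => ?_
  have := O.relation i j hij α β
  have hR : ∑ k, (O.coeff k : ℝ) * (if O.state k i = α ∧ O.state k j = β then 1 else 0) = 0 := by
    exact_mod_cast this
  refine Eq.trans ?_ ((congrArg (h α β * ·) hR).trans (mul_zero _))
  simp only [Finset.mul_sum]
  exact Finset.sum_congr rfl fun k _ => by ring

/-- If `G` contracts onto the interaction graph of the variables of `O`, then its marginal
polytope is not compressed. -/
theorem not_isCompressed {V : Type*} [Fintype V] [DecidableEq V] {G : SimpleGraph V}
    {𝓕 : Finset (Finset V)} (h𝓕 : ∀ F, F ∈ 𝓕 ↔ ∃ u v, G.Adj u v ∧ F = {u, v})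
    (B : Fin m → Set V) (hdisj : ∀ i j v, v ∈ B i → v ∈ B j → i = j)
    (hconn : ∀ i, (G.induce (B i)).Connected)
    (hadj : ∀ i j u v, i ≠ j → u ∈ B i → v ∈ B j → G.Adj u v →
      (i, j) ∈ O.pairs ∨ (j, i) ∈ O.pairs)
    (hedge : ∀ p ∈ O.pairs, ∃ u ∈ B p.1, ∃ v ∈ B p.2, G.Adj u v) :
    ¬ IsCompressed (Set.range (margVec 𝓕 (fun _ => 2))) := by
  classical
  choose u hu v hv huv using hedge
  set a := margVec 𝓕 (fun _ : V => 2) with ha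
  have hpair : ∀ {u v}, G.Adj u v → ∀ h : Fin 2 → Fin 2 → ℝ,
      IsAffineOn a fun x => h (x u) (x v) :=
    fun huv h => isAffineOn_pair ((h𝓕 _).2 ⟨_, _, huv, rfl⟩) h
  set f₀ : (V → Fin 2) → ℝ := fun x =>
    (O.base : ℝ) + ∑ p ∈ O.pairs.attach, (O.coupling (x (u p.1 p.2)) (x (v p.1 p.2)) : ℝ) with hf₀
  set pen : (V → Fin 2) → ℝ := fun x => ∑ u, ∑ v,
    if G.Adj u v ∧ ∃ i, u ∈ B i ∧ v ∈ B i then (if x u = x v then (0 : ℝ) else 1) else 0 with hpen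
  have hpen_eq : ∀ x (t : Fin m → Fin 2), (∀ i, ∀ u ∈ B i, x u = t i) → pen x = 0 := by
    intro x t hx
    refine Finset.sum_eq_zero fun u _ => Finset.sum_eq_zero fun v _ => ?_
    split_ifs with h h'
    · rfl
    · obtain ⟨_, i, hi, hi'⟩ := h
      exact absurd ((hx i u hi).trans (hx i v hi').symm) h'
    · rfl
  have hf₀_eq : ∀ x (t : Fin m → Fin 2), (∀ i, ∀ u ∈ B i, x u = t i) →
      f₀ x = ((O.base + ∑ p ∈ O.pairs, O.coupling (t p.1) (t p.2) : ℤ) : ℝ) := by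
    intro x t hx
    simp only [hf₀]
    push_cast
    rw [← Finset.sum_attach O.pairs]
    congr 1
    refine Finset.sum_congr rfl fun p _ => ?_
    rw [hx _ _ (hu p.1 p.2), hx _ _ (hv p.1 p.2)]
  have hterm : ∀ (x : V → Fin 2) u v, (0 : ℝ) ≤
      if G.Adj u v ∧ ∃ i, u ∈ B i ∧ v ∈ B i then (if x u = x v then (0 : ℝ) else 1) else 0 := by
    intro x u v
    split_ifs <;> norm_num
  have hpen_cases : ∀ x, (∃ t : Fin m → Fin 2, ∀ i, ∀ u ∈ B i, x u = t i) ∨ 1 ≤ pen x := by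
    intro x
    by_cases h : ∀ u v, (G.Adj u v ∧ ∃ i, u ∈ B i ∧ v ∈ B i) → x u = x v
    · left
      choose b hb using fun i => ((induce_connected_iff_closed G _).1 (hconn i)).1
      refine ⟨fun i => x (b i), fun i w hw => ?_⟩
      have := ((induce_connected_iff_closed G _).1 (hconn i)).2 {y | x y = x (b i)}
        (fun y hy z hz hyz (hyS : x y = x (b i)) => (h y z ⟨hyz, i, hy, hz⟩).symm.trans hyS)
        (b i) (hb i) w hw rfl
      exact this
    · right
      push Not at h
      obtain ⟨y, z, hyz, hne⟩ := h
      calc (1 : ℝ) = if G.Adj y z ∧ ∃ i, y ∈ B i ∧ z ∈ B i then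
            (if x y = x z then (0 : ℝ) else 1) else 0 := by rw [if_pos hyz, if_neg hne]
        _ ≤ ∑ v, if G.Adj y v ∧ ∃ i, y ∈ B i ∧ v ∈ B i then
            (if x y = x v then (0 : ℝ) else 1) else 0 :=
          Finset.single_le_sum (f := fun v => if G.Adj y v ∧ ∃ i, y ∈ B i ∧ v ∈ B i then
            (if x y = x v then (0 : ℝ) else 1) else 0) (fun v _ => hterm x y v) (Finset.mem_univ z)
        _ ≤ pen x :=
          Finset.single_le_sum (f := fun u => ∑ v, if G.Adj u v ∧ ∃ i, u ∈ B i ∧ v ∈ B i then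
            (if x u = x v then (0 : ℝ) else 1) else 0)
            (fun u _ => Finset.sum_nonneg fun v _ => hterm x u v) (Finset.mem_univ y)
  have hf₀_affine : IsAffineOn a f₀ := by
    refine (IsAffineOn.const _).add (IsAffineOn.sum _ fun p _ => ?_)
    exact hpair (huv p.1 p.2) fun α β => (O.coupling α β : ℝ)
  have hpen_affine : IsAffineOn a pen := by
    refine IsAffineOn.sum _ fun u _ => IsAffineOn.sum _ fun v _ => ?_
    by_cases h : G.Adj u v ∧ ∃ i, u ∈ B i ∧ v ∈ B i
    · simp only [if_pos h]
      exact hpair h.1 fun α β => if α = β then (0 : ℝ) else 1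
    · simp only [if_neg h]
      exact IsAffineOn.const 0
  set M : ℝ := ∑ x, |f₀ x| with hM
  have hM0 : 0 ≤ M := Finset.sum_nonneg fun x _ => abs_nonneg _
  obtain ⟨ℓ, hℓ⟩ : ∃ ℓ : (MargIndex 𝓕 (fun _ => 2) → ℝ) →ᵃ[ℝ] ℝ,
      ∀ x, ℓ (a x) = M * pen x + f₀ x := (hpen_affine.const_mul M).add hf₀_affine
  set lift : (Fin m → Fin 2) → V → Fin 2 := fun t w =>
    if h : ∃ i, w ∈ B i then t h.choose else 0 with hlift
  have hlift_mem : ∀ t i w, w ∈ B i → lift t w = t i := by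
    intro t i w hw
    have h : ∃ i, w ∈ B i := ⟨i, hw⟩
    simp only [hlift]
    rw [dif_pos h, hdisj _ _ _ h.choose_spec hw]
  have hlift_not : ∀ t w, (¬ ∃ i, w ∈ B i) → lift t w = 0 := fun t w h => dif_neg h
  have hℓ_lift : ∀ t, ℓ (a (lift t)) =
      ((O.base + ∑ p ∈ O.pairs, O.coupling (t p.1) (t p.2) : ℤ) : ℝ) := by
    intro t
    rw [hℓ, hpen_eq _ t fun i u hu => hlift_mem t i u hu,
      hf₀_eq _ t fun i u hu => hlift_mem t i u hu, mul_zero, zero_add]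
  have hcsum : ∑ k, (O.coeff k : ℝ) = 0 := by exact_mod_cast O.sum_coeff
  have hrel : ∀ y z, G.Adj y z → ∀ h : Fin 2 → Fin 2 → ℝ,
      ∑ k, (O.coeff k : ℝ) * h (lift (O.state k) y) (lift (O.state k) z) = 0 := by
    intro y z hyz h
    by_cases hy : ∃ i, y ∈ B i <;> by_cases hz : ∃ i, z ∈ B i
    · obtain ⟨i, hi⟩ := hy
      obtain ⟨j, hj⟩ := hz
      simp only [hlift_mem _ i y hi, hlift_mem _ j z hj]
      by_cases hij : i = j
      · exact O.sum_coeff_mul (Or.inl hij) h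
      · rcases hadj i j y z hij hi hj hyz with h' | h'
        · exact O.sum_coeff_mul (Or.inr h') h
        · exact O.sum_coeff_mul (Or.inr h') fun α β => h β α
    · obtain ⟨i, hi⟩ := hy
      simp only [hlift_mem _ i y hi, hlift_not _ z hz]
      exact O.sum_coeff_mul (Or.inl (rfl : i = i)) fun α _ => h α 0
    · obtain ⟨j, hj⟩ := hz
      simp only [hlift_mem _ j z hj, hlift_not _ y hy]
      exact O.sum_coeff_mul (Or.inl (rfl : j = j)) fun α _ => h 0 α
    · simp only [hlift_not _ y hy, hlift_not _ z hz]
      rw [← Finset.sum_mul, hcsum, zero_mul]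
  refine not_isCompressed_of_relation (a := a) (fun k => lift (O.state k)) (c := fun k => O.coeff k)
    hcsum ?_ O.q_ne_r (by exact_mod_cast O.coeff_q) (by exact_mod_cast O.coeff_qr) (ℓ := ℓ)
    ?_ ?_ ?_ O.exists_root
  · funext e
    obtain ⟨y, z, hyz, α, β, he⟩ := margVec_eq_spin h𝓕 e
    simp only [Finset.sum_apply, Pi.smul_apply, smul_eq_mul, Pi.zero_apply, ha, he]
    exact hrel y z hyz fun s t => (1 + spin α * spin s) / 2 * ((1 + spin β * spin t) / 2)
  · intro x
    rw [hℓ]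
    rcases hpen_cases x with ⟨t, ht⟩ | h
    · rw [hpen_eq x t ht, hf₀_eq x t ht, mul_zero, zero_add]
      exact_mod_cast O.energy_nonneg t
    · have h1 : |f₀ x| ≤ M :=
        Finset.single_le_sum (f := fun x => |f₀ x|) (fun x _ => abs_nonneg _) (Finset.mem_univ x)
      have h2 := neg_abs_le (f₀ x)
      nlinarith
  · rw [hℓ_lift]
    exact_mod_cast O.energy_q
  · intro k hq hr
    rw [hℓ_lift]
    exact_mod_cast O.energy_root k hq hr

/-- The relation on the complete graph `K₄`. -/
def complete : EnergyRelation 4 where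
  pairs := Finset.univ.filter fun p => p.1 < p.2
  base := 6
  coupling := ![![5, -3], ![-3, 1]]
  size := 12
  state := ![![1, 1, 1, 1], ![0, 0, 0, 0],
    ![0, 0, 1, 1], ![0, 1, 0, 1], ![0, 1, 1, 0], ![1, 0, 0, 1], ![1, 0, 1, 0], ![1, 1, 0, 0],
    ![0, 1, 1, 1], ![1, 0, 1, 1], ![1, 1, 0, 1], ![1, 1, 1, 0]]
  coeff := ![-3, 1, -1, -1, -1, -1, -1, -1, 2, 2, 2, 2]
  q := 0
  r := 1
  energy_nonneg := by decide
  sum_coeff := by decide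
  relation := by decide
  q_ne_r := by decide
  coeff_q := by decide
  coeff_qr := by decide
  energy_q := by decide
  energy_root := by decide
  exists_root := by decide

/-- The relation on the cycle of length five. -/
def pentagon : EnergyRelation 5 where
  pairs := Finset.univ.filter fun p => p.2 = p.1 + 1
  base := 3
  coupling := ![![1, -1], ![-1, 1]]
  size := 7
  state := ![![0, 0, 0, 0, 1], ![0, 0, 0, 0, 0], ![0, 0, 1, 0, 1], ![0, 1, 0, 0, 1],
    ![0, 1, 0, 1, 0], ![1, 0, 0, 1, 0], ![1, 0, 1, 0, 0]]
  coeff := ![2, -1, -1, -1, 1, -1, 1]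
  q := 0
  r := 1
  energy_nonneg := by decide
  sum_coeff := by decide
  relation := by decide
  q_ne_r := by decide
  coeff_q := by decide
  coeff_qr := by decide
  energy_q := by decide
  energy_root := by decide
  exists_root := by decide

end EnergyRelation

lemma IsSeqCycle.isSeqPath {V : Type*} {G : SimpleGraph V} {k : ℕ} {c : ℕ → V}
    (hc : IsSeqCycle G k c) : IsSeqPath G (k - 1) c := by
  refine ⟨fun i hi j hj h => ?_, fun i hi => (hc.2 i (i + 1) (by omega) (by omega)).2 (.inl rfl)⟩
  by_cases hk : k = 0
  · omega
  · exact hc.1 i (by omega) j (by omega) h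

theorem not_isCompressed_of_hasK4Minor {V : Type*} [Fintype V] [DecidableEq V]
    {G : SimpleGraph V} {𝓕 : Finset (Finset V)}
    (h𝓕 : ∀ F, F ∈ 𝓕 ↔ ∃ u v, G.Adj u v ∧ F = {u, v}) (hG : HasK4Minor G) :
    ¬ IsCompressed (Set.range (margVec 𝓕 (fun _ => 2))) := by
  obtain ⟨B, -, hdisj, hconn, hadj⟩ := hG
  refine EnergyRelation.complete.not_isCompressed h𝓕 B ?_ hconn ?_ ?_
  · intro i j v hi hj
    by_contra hij
    exact Set.disjoint_left.1 (hdisj i j hij) hi hj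
  · intro i j u v hij _ _ _
    simpa [EnergyRelation.complete] using lt_or_gt_of_ne hij
  · intro p hp
    exact hadj _ _ (ne_of_lt (by simpa [EnergyRelation.complete] using hp))

theorem not_isCompressed_of_isSeqCycle {V : Type*} [Fintype V] [DecidableEq V]
    {G : SimpleGraph V} {𝓕 : Finset (Finset V)}
    (h𝓕 : ∀ F, F ∈ 𝓕 ↔ ∃ u v, G.Adj u v ∧ F = {u, v}) {k : ℕ} (hk : 5 ≤ k) {c : ℕ → V}
    (hc : IsSeqCycle G k c) : ¬ IsCompressed (Set.range (margVec 𝓕 (fun _ => 2))) := by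
  set last : Fin 5 → ℕ := fun i => if (i : ℕ) = 4 then k - 1 else i with hlast
  have hlast_of : ∀ i : Fin 5, ((i : ℕ) = 4 ∧ last i = k - 1) ∨ ((i : ℕ) < 4 ∧ last i = i) := by
    intro i
    simp only [hlast]
    split_ifs with h
    · exact .inl ⟨h, rfl⟩
    · exact .inr ⟨by omega, rfl⟩
  have hmem : ∀ i j : Fin 5, (i, j) ∈ EnergyRelation.pentagon.pairs ↔
      ((j : ℕ) = i + 1 ∨ ((i : ℕ) = 4 ∧ (j : ℕ) = 0)) := by decide
  refine EnergyRelation.pentagon.not_isCompressed h𝓕 (fun i => c '' Set.Icc (i : ℕ) (last i))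
    ?_ ?_ ?_ ?_
  · rintro i j _ ⟨s, ⟨hs, hs'⟩, rfl⟩ ⟨t, ⟨ht, ht'⟩, hst⟩
    have hi := hlast_of i
    have hj := hlast_of j
    have := hc.1 t (by omega) s (by omega) hst
    omega
  · intro i
    have hi := hlast_of i
    exact hc.isSeqPath.connected_interval (by omega) (by omega)
  · rintro i j _ _ hij ⟨s, ⟨hs, hs'⟩, rfl⟩ ⟨t, ⟨ht, ht'⟩, rfl⟩ hst
    have hi := hlast_of i
    have hj := hlast_of j
    have hij' : (i : ℕ) ≠ j := fun h => hij (Fin.ext h)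
    rw [hmem, hmem]
    rcases lt_trichotomy s t with h | h | h
    · have := (hc.2 s t h (by omega)).1 hst
      omega
    · exact absurd (h ▸ hst) (G.irrefl)
    · have := (hc.2 t s h (by omega)).1 hst.symm
      omega
  · rintro ⟨i, j⟩ hij
    rw [hmem] at hij
    have hi := hlast_of i
    have hj := hlast_of j
    rcases hij with h | ⟨h, h'⟩
    · exact ⟨_, ⟨i, ⟨le_rfl, by dsimp only; omega⟩, rfl⟩, _, ⟨j, ⟨le_rfl, by dsimp only; omega⟩, rfl⟩,
        (hc.2 i j (by omega) (by omega)).2 (.inl h)⟩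
    · exact ⟨_, ⟨k - 1, ⟨by dsimp only; omega, by dsimp only; omega⟩, rfl⟩, _, ⟨0, ⟨by dsimp only; omega, by dsimp only; omega⟩, rfl⟩,
        ((hc.2 0 (k - 1) (by omega) (by omega)).2 (.inr ⟨rfl, by omega⟩)).symm⟩

/-- Theorem 5.10: for a graph `Δ` on `[n]` with edge family `𝓕` and binary levels
`d = (2,…,2)`, the marginal polytope `P_{𝓕,d}` is compressed if and only if `Δ` has no `K₄`
minor and every induced cycle in `Δ` has length at most `4`. -/
theorem marginal_graph_binary_compressed_iff
    (n : ℕ) (G : SimpleGraph (Fin n)) (𝓕 : Finset (Finset (Fin n)))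
    (h𝓕 : ∀ F, F ∈ 𝓕 ↔ ∃ u v, G.Adj u v ∧ F = {u, v}) :
    IsCompressed (Set.range (margVec 𝓕 (fun _ => 2))) ↔
      ¬ HasK4Minor G ∧ InducedCyclesLe4 G := by
  refine ⟨fun h => ⟨fun hK => not_isCompressed_of_hasK4Minor h𝓕 hK h, ?_⟩,
    fun h => isCompressed_of_noK4Minor_of_inducedCyclesLe4 h𝓕 h.1 h.2⟩
  intro k _ v hv hadj
  by_contra! hk4
  exact not_isCompressed_of_isSeqCycle h𝓕 hk4
    (isSeqCycle_of_zmod (f := id) hv hadj Function.injective_id fun _ _ => Iff.rfl) h
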